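/- Let q be a power of a prime and F_q the finite field with q elements. Let A, B ⊆ F_q with 2 ≤ |B| ≤ |A|, and suppose there is a constant C > 0 such that for every proper subfield G of F_q and all elements c, d ∈ F_q one has |A ∩ (cG + d)| ≤ C·max{|G|^{1/2}, |A|^{31/191}|B|^{129/191}}. Then there is a constant c' > 0 depending only on C such that L(A × B) ≥ c'·min{|A|^{380/191}|B|^{4/191}, q^{2/103}|A|^{204/103}, |B|^{4}}. -/

import Mathlib

open scoped Classical Pointwise

noncomputable section

namespace STP

variable {F : Type} [Field F]

def collinearTriples (A B : Finset F) : ℕ :=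
  (((A ×ˢ A ×ˢ A) ×ˢ (B ×ˢ B ×ˢ B)).filter fun x =>
    (x.1.2.1 - x.1.1) * (x.2.2.2 - x.2.1) = (x.1.2.2 - x.1.1) * (x.2.2.1 - x.2.1)).card

def IsLine (l : Set (F × F)) : Prop :=
  ∃ a b c : F, (a, b) ≠ (0, 0) ∧ l = {p : F × F | a * p.1 + b * p.2 = c}

def incidences (P : Finset (F × F)) (L : Finset (Set (F × F))) : ℕ :=
  ((P ×ˢ L).filter fun x => x.1 ∈ x.2).card

def kIncidences (P : Finset (F × F)) (L : Finset (Set (F × F))) (k : ℕ) : ℕ :=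
  (((Fintype.piFinset fun _ : Fin k => P) ×ˢ L).filter fun x => ∀ i, x.1 i ∈ x.2).card

def numLines (P : Finset (F × F)) : ℕ :=
  Set.ncard {l : Set (F × F) | IsLine l ∧ 2 ≤ (P.filter (· ∈ l)).card}

def addEnergy (X Y : Finset F) : ℕ :=
  (((X ×ˢ X) ×ˢ (Y ×ˢ Y)).filter fun t => t.1.1 + t.2.1 = t.1.2 + t.2.2).card

def mulEnergy (A : Finset F) : ℕ :=
  (((A ×ˢ A) ×ˢ (A ×ˢ A)).filter fun t => t.1.1 * t.2.1 = t.1.2 * t.2.2).card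

def quotSet (X : Finset F) : Set F :=
  {r : F | ∃ x1 ∈ X, ∃ x2 ∈ X, ∃ x3 ∈ X, ∃ x4 ∈ X, x3 ≠ x4 ∧ r = (x1 - x2) / (x3 - x4)}

def subfieldCond (A : Finset F) (C bound : ℝ) : Prop :=
  ∀ G : Subfield F, G ≠ ⊤ → ∀ c d : F,
    ((A.filter fun x => ∃ g ∈ G, x = c * g + d).card : ℝ) ≤
      C * max ((Nat.card G : ℝ) ^ ((1:ℝ)/2)) bound

def linesOf [Fintype F] (P : Finset (F × F)) : Finset (Set (F × F)) :=
  Set.Finite.toFinset (Set.toFinite {l : Set (F × F) | IsLine l ∧ 2 ≤ (P.filter (· ∈ l)).card})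

def tripleCount [Fintype F] (P : Finset (F × F)) : ℕ :=
  ∑ l ∈ linesOf P, ((P.filter (· ∈ l)).card) ^ 3

/-- Good dilates: every part of `A` contains a large piece mapped by `s` into a translate of `Q`. -/
def Good (A : Finset F) (γ : ℝ) (s : F) (n : ℕ) (Q : Finset F) : Prop :=
  ∀ Z ⊆ A, ∃ Y ⊆ Z, γ ^ n * (Z.card : ℝ) ≤ Y.card ∧ ∃ x, ∀ y ∈ Y, s * y - x ∈ Q

theorem good_one (A : Finset F) (γ : ℝ) : Good A γ 1 0 A := by
  intro Z hZ
  refine ⟨Z, subset_rfl, by simp, 0, fun y hy => by simpa using hZ hy⟩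

theorem Good.add {A : Finset F} {γ : ℝ} (hγ : 0 ≤ γ) {s s' : F} {n n' : ℕ} {Q Q' : Finset F}
    (h : Good A γ s n Q) (h' : Good A γ s' n' Q') : Good A γ (s + s') (n + n') (Q + Q') := by
  intro Z hZ
  obtain ⟨Y, hY, hc, x, hx⟩ := h Z hZ
  obtain ⟨Y', hY', hc', x', hx'⟩ := h' Y (hY.trans hZ)
  refine ⟨Y', hY'.trans hY, ?_, x + x', fun y hy => ?_⟩
  · calc γ ^ (n + n') * (Z.card : ℝ) = γ ^ n' * (γ ^ n * Z.card) := by ring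
      _ ≤ γ ^ n' * Y.card := by gcongr
      _ ≤ _ := hc'
  · have := Finset.add_mem_add (hx y (hY' hy)) (hx' y hy)
    convert this using 1
    ring

theorem Good.sub {A : Finset F} {γ : ℝ} (hγ : 0 ≤ γ) {s s' : F} {n n' : ℕ} {Q Q' : Finset F}
    (h : Good A γ s n Q) (h' : Good A γ s' n' Q') : Good A γ (s - s') (n + n') (Q - Q') := by
  intro Z hZ
  obtain ⟨Y, hY, hc, x, hx⟩ := h Z hZ
  obtain ⟨Y', hY', hc', x', hx'⟩ := h' Y (hY.trans hZ)
  refine ⟨Y', hY'.trans hY, ?_, x - x', fun y hy => ?_⟩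
  · calc γ ^ (n + n') * (Z.card : ℝ) = γ ^ n' * (γ ^ n * Z.card) := by ring
      _ ≤ γ ^ n' * Y.card := by gcongr
      _ ≤ _ := hc'
  · have := Finset.sub_mem_sub (hx y (hY' hy)) (hx' y hy)
    convert this using 1
    ring

theorem Good.comp {A : Finset F} (hA : A.Nonempty) {β D : ℝ} (hβ : 0 ≤ β) (hD : 0 < D)
    (hAA : ((A - A).card : ℝ) ≤ D * A.card) {s t : F} {n : ℕ}
    (ht : ∃ W ⊆ A, β * A.card ≤ (W.card : ℝ) ∧ ∃ x, ∀ w ∈ W, ∃ a ∈ A, w = t * a + x)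
    (h : Good A (β / D) s n A) : Good A (β / D) (t * s) (n + 1) A := by
  intro Z hZ
  obtain ⟨Y, hY, hc, x, hx⟩ := h Z hZ
  obtain ⟨W, hWA, hW, x', hx'⟩ := ht
  let T := (A - A).image (fun d => t * d - x')
  have hTne : T.Nonempty := (hA.sub hA).image _
  have hTc : (T.card : ℝ) ≤ D * A.card := le_trans (by exact_mod_cast Finset.card_image_le) hAA
  have hmap : ∀ p ∈ Y ×ˢ W, (t * (s * p.1 - x) - p.2) ∈ T := by
    rintro ⟨y, w⟩ hp
    rw [Finset.mem_product] at hp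
    obtain ⟨a, ha, hw⟩ := hx' w hp.2
    refine Finset.mem_image.2 ⟨(s * y - x) - a, Finset.sub_mem_sub (hx y hp.1) ha, ?_⟩
    simp only [hw]; ring
  have hTpos : (0:ℝ) < T.card := by exact_mod_cast hTne.card_pos
  obtain ⟨z, hz, hzc⟩ := Finset.exists_le_card_fiber_of_nsmul_le_card_of_maps_to (M := ℝ)
    (b := (Y.card * W.card : ℝ) / T.card) hmap hTne (by
      rw [Finset.card_product, nsmul_eq_mul, mul_div_cancel₀ _ hTpos.ne']; push_cast; rfl)
  refine ⟨Y.filter (fun y => t * (s * y - x) - z ∈ W), (Finset.filter_subset _ _).trans hY, ?_,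
    t * x + z, fun y hy => ?_⟩
  · have h1 : ((Y ×ˢ W).filter (fun p => t * (s * p.1 - x) - p.2 = z)).card ≤
        (Y.filter (fun y => t * (s * y - x) - z ∈ W)).card := by
      refine Finset.card_le_card_of_injOn Prod.fst ?_ ?_
      · rintro ⟨y, w⟩ hp
        simp only [Finset.coe_filter, Finset.mem_product, Set.mem_ofPred_eq] at hp ⊢
        refine ⟨hp.1.1, ?_⟩
        have : t * (s * y - x) - z = w := by rw [← hp.2]; ring
        rw [this]; exact hp.1.2
      · rintro ⟨y, w⟩ hp ⟨y', w'⟩ hp' hyy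
        simp only [Finset.coe_filter, Finset.mem_product, Set.mem_ofPred_eq] at hp hp' hyy
        subst hyy
        have : w = w' := by
          have := hp.2.trans hp'.2.symm
          exact sub_right_injective this
        rw [this]
    have hApos : (0:ℝ) < A.card := by exact_mod_cast hA.card_pos
    have h2 : β / D * (Y.card : ℝ) ≤ (Y.card * W.card : ℝ) / T.card := by
      rw [le_div_iff₀ hTpos]
      calc β / D * (Y.card : ℝ) * T.card ≤ β / D * (Y.card : ℝ) * (D * A.card) := by gcongr
        _ = Y.card * (β * A.card) := by field_simp
        _ ≤ Y.card * W.card := by gcongr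
    calc (β / D) ^ (n + 1) * (Z.card : ℝ) = β / D * ((β / D) ^ n * Z.card) := by ring
      _ ≤ β / D * Y.card := by gcongr
      _ ≤ _ := h2
      _ ≤ _ := hzc
      _ ≤ _ := by exact_mod_cast h1
  · rw [Finset.mem_filter] at hy
    have := hWA hy.2
    convert this using 1
    ring

theorem Good.cover {A : Finset F} (hA : A.Nonempty) {γ : ℝ} (hγ : 0 < γ)
    {s : F} {n : ℕ} {Q : Finset F} (h : Good A γ s n Q) :
    ∃ Y ⊆ A, (A.card : ℝ) ≤ 2 * Y.card ∧
      ((A + Y.image (fun y => s * y)).card : ℝ) * (γ ^ n * A.card) ≤ 2 * Y.card * (A + Q).card := by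
  let P : Finset F → Prop := fun Y =>
    ((A + Y.image (fun y => s * y)).card : ℝ) * (γ ^ n * A.card) ≤ 2 * Y.card * (A + Q).card
  have hne : (A.powerset.filter P).Nonempty := ⟨∅, by simp [P]⟩
  obtain ⟨Y, hY, hmax⟩ := Finset.exists_max_image _ Finset.card hne
  rw [Finset.mem_filter, Finset.mem_powerset] at hY
  refine ⟨Y, hY.1, ?_, hY.2⟩
  by_contra hlt
  push Not at hlt
  obtain ⟨Y1, hY1, hc, x, hx⟩ := h (A \ Y) Finset.sdiff_subset
  have hApos : (0:ℝ) < A.card := by exact_mod_cast hA.card_pos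
  have hsd : ((A \ Y).card : ℝ) = A.card - Y.card := by
    rw [Finset.card_sdiff_of_subset hY.1, Nat.cast_sub (Finset.card_le_card hY.1)]
  have hdisj : Disjoint Y Y1 :=
    Finset.disjoint_of_subset_right hY1 Finset.disjoint_sdiff
  have hcu : (Y ∪ Y1).card = Y.card + Y1.card := Finset.card_union_of_disjoint hdisj
  have hγn : 0 < γ ^ n := by positivity
  have hY1c : γ ^ n * A.card ≤ 2 * Y1.card := by
    rw [hsd] at hc
    nlinarith
  have hY1pos : 0 < Y1.card := by
    have : (0:ℝ) < 2 * Y1.card := lt_of_lt_of_le (by positivity) hY1c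
    have : (0:ℝ) < Y1.card := by linarith
    exact_mod_cast this
  have hmem : Y ∪ Y1 ∈ A.powerset.filter P := by
    rw [Finset.mem_filter, Finset.mem_powerset]
    refine ⟨Finset.union_subset hY.1 (hY1.trans Finset.sdiff_subset), ?_⟩
    have h1 : (A + (Y ∪ Y1).image (fun y => s * y)).card ≤
        (A + Y.image (fun y => s * y)).card + (A + Q).card := by
      rw [Finset.image_union, Finset.add_union]
      refine (Finset.card_union_le _ _).trans (Nat.add_le_add_left ?_ _)
      refine Finset.card_le_card_of_injOn (fun z => z - x) ?_ (fun a _ b _ h => sub_left_injective h)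
      intro z hz
      simp only [Finset.coe_add, Finset.coe_image] at hz
      obtain ⟨a, ha, w, ⟨y, hy, rfl⟩, rfl⟩ := hz
      have := Finset.add_mem_add (Finset.mem_coe.1 ha) (hx y hy)
      simp only [Finset.mem_coe]
      convert this using 1
      ring
    have h1' : ((A + (Y ∪ Y1).image (fun y => s * y)).card : ℝ) ≤
        (A + Y.image (fun y => s * y)).card + (A + Q).card := by exact_mod_cast h1
    have h2 : ((A + Y.image (fun y => s * y)).card : ℝ) * (γ ^ n * A.card)
      ≤ 2 * Y.card * (A + Q).card := hY.2
    change ((A + (Y ∪ Y1).image (fun y => s * y)).card : ℝ) * (γ ^ n * A.card) ≤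
      2 * ((Y ∪ Y1).card : ℝ) * (A + Q).card
    rw [hcu]; push_cast
    calc ((A + (Y ∪ Y1).image (fun y => s * y)).card : ℝ) * (γ ^ n * A.card)
        ≤ ((A + Y.image (fun y => s * y)).card + (A + Q).card) * (γ ^ n * A.card) := by gcongr
      _ = (A + Y.image (fun y => s * y)).card * (γ ^ n * A.card) + (A + Q).card * (γ ^ n * A.card) := by
          ring
      _ ≤ 2 * Y.card * (A + Q).card + (A + Q).card * (2 * Y1.card) := by gcongr
      _ = _ := by ring
  have := hmax _ hmem
  omega

theorem card_sq_le_fiber {X Z : Type*} (P : Finset X) (f : X → Z) :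
    ((P.card : ℝ)) ^ 2 ≤ (P.image f).card * ((P ×ˢ P).filter (fun p => f p.1 = f p.2)).card := by
  have h1 : P.card = ∑ z ∈ P.image f, (P.filter (fun p => f p = z)).card :=
    Finset.card_eq_sum_card_image f P
  have h2 : ((P ×ˢ P).filter (fun p => f p.1 = f p.2)).card
      = ∑ z ∈ P.image f, (P.filter (fun p => f p = z)).card ^ 2 := by
    rw [Finset.card_eq_sum_card_fiberwise (f := fun p => f p.1) (t := P.image f)]
    · refine Finset.sum_congr rfl fun z hz => ?_
      rw [sq, ← Finset.card_product]
      congr 1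
      ext ⟨p, p'⟩
      simp only [Finset.mem_filter, Finset.mem_product]
      constructor
      · rintro ⟨⟨⟨a, b⟩, c⟩, d⟩; exact ⟨⟨a, d⟩, b, by rw [← c, d]⟩
      · rintro ⟨⟨a, d⟩, b, c⟩; exact ⟨⟨⟨a, b⟩, by rw [c, d]⟩, d⟩
    · intro p hp
      simp only [Finset.coe_filter, Finset.mem_product, Set.mem_ofPred_eq] at hp
      exact Finset.mem_coe.2 (Finset.mem_image_of_mem _ hp.1.1)
  rw [h2, h1]
  push_cast
  exact sq_sum_le_card_mul_sum_sq

/-- Energy of `A` against its dilate by `s`. -/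
def en (A : Finset F) (s : F) : ℕ :=
  (((A ×ˢ A) ×ˢ (A ×ˢ A)).filter fun p => p.1.1 + s * p.1.2 = p.2.1 + s * p.2.2).card

theorem en_sum (A S : Finset F) : ∑ s ∈ S, en A s ≤ A.card ^ 4 + S.card * A.card ^ 2 := by
  have : ∀ s ∈ S, en A s ≤ (((A ×ˢ A) ×ˢ (A ×ˢ A)).filter
      fun p => p.1.2 ≠ p.2.2 ∧ s = (p.2.1 - p.1.1) / (p.1.2 - p.2.2)).card + A.card ^ 2 := by
    intro s _
    have h2 : (((A ×ˢ A) ×ˢ (A ×ˢ A)).filter fun p => p.1 = p.2).card ≤ A.card ^ 2 := by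
      rw [sq, ← Finset.card_product]
      refine Finset.card_le_card_of_injOn Prod.fst ?_ ?_
      · intro p hp
        simp only [Finset.coe_filter, Set.mem_ofPred_eq, Finset.mem_product] at hp ⊢
        exact Finset.mem_coe.2 (Finset.mem_product.2 hp.1.1)
      · rintro ⟨p, p'⟩ hp ⟨r, r'⟩ hr h
        simp only [Finset.coe_filter, Set.mem_ofPred_eq] at hp hr h
        rw [← hp.2, ← hr.2, h]
    refine le_trans ?_ (Nat.add_le_add_left h2 _)
    refine le_trans (Finset.card_le_card ?_) (Finset.card_union_le _ _)
    rintro ⟨⟨a, b⟩, ⟨c, d⟩⟩ hp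
    simp only [Finset.mem_filter, Finset.mem_union, Prod.mk.injEq] at hp ⊢
    by_cases hbd : b = d
    · right
      refine ⟨hp.1, ?_, hbd⟩
      have := hp.2
      rw [hbd] at this
      exact add_right_cancel this
    · left
      refine ⟨hp.1, hbd, ?_⟩
      rw [eq_div_iff (sub_ne_zero.2 hbd)]
      linear_combination hp.2
  refine (Finset.sum_le_sum this).trans ?_
  rw [Finset.sum_add_distrib, Finset.sum_const, smul_eq_mul]
  refine Nat.add_le_add_right ?_ _
  have h4 : A.card ^ 4 = ((A ×ˢ A) ×ˢ (A ×ˢ A)).card := by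
    simp only [Finset.card_product]; ring
  rw [h4]
  rw [← Finset.card_biUnion]
  · exact Finset.card_le_card (Finset.biUnion_subset.2 fun s _ => Finset.filter_subset _ _)
  · intro s _ s' _ hss
    rw [Function.onFun, Finset.disjoint_left]
    intro p hp hp'
    rw [Finset.mem_filter] at hp hp'
    exact hss (hp.2.2.trans hp'.2.2.symm)

theorem en_lower (A Y : Finset F) (hY : Y ⊆ A) (s : F) :
    ((A.card : ℝ) * Y.card) ^ 2 ≤ (A + Y.image (fun y => s * y)).card * en A s := by
  have h := card_sq_le_fiber (A ×ˢ Y) (fun p : F × F => p.1 + s * p.2)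
  rw [Finset.card_product] at h
  push_cast at h
  refine h.trans ?_
  gcongr
  · intro z hz
    obtain ⟨p, hp, rfl⟩ := Finset.mem_image.1 hz
    rw [Finset.mem_product] at hp
    exact Finset.add_mem_add hp.1 (Finset.mem_image_of_mem _ hp.2)
  · unfold en
    refine Finset.card_le_card (Finset.filter_subset_filter _ ?_)
    exact Finset.product_subset_product (Finset.product_subset_product_right hY)
      (Finset.product_subset_product_right hY)

/-- Few dilates can be good. -/
theorem few_good (A S : Finset F) (hA : A.Nonempty) (κ : ℝ) (hκ : 0 < κ)
    (hκn : 8 ≤ κ * A.card)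
    (h : ∀ s ∈ S, ∃ Y ⊆ A, (A.card : ℝ) ≤ 2 * Y.card ∧
      ((A + Y.image (fun y => s * y)).card : ℝ) * κ ≤ A.card) :
    κ * S.card ≤ 8 * A.card := by
  have hApos : (0:ℝ) < A.card := by exact_mod_cast hA.card_pos
  set n : ℝ := (A.card : ℝ) with hn
  have h1 : ∀ s ∈ S, κ * n ^ 3 / 4 ≤ (en A s : ℝ) := by
    intro s hs
    obtain ⟨Y, hYA, hY, hc⟩ := h s hs
    have h2 := en_lower A Y hYA s
    rw [← hn] at h2
    have h3 : (n * (n / 2)) ^ 2 ≤ (n * Y.card) ^ 2 := by gcongr; linarith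
    have h4 : κ * (n * (n / 2)) ^ 2 ≤ n * en A s := by
      calc κ * (n * (n / 2)) ^ 2 ≤ κ * ((A + Y.image (fun y => s * y)).card * en A s) := by
            gcongr; exact h3.trans h2
        _ = ((A + Y.image (fun y => s * y)).card * κ) * en A s := by ring
        _ ≤ n * en A s := by gcongr
    have h5 : n * (κ * n ^ 3 / 4) ≤ n * en A s := by
      calc _ = κ * (n * (n / 2)) ^ 2 := by ring
        _ ≤ _ := h4
    exact le_of_mul_le_mul_left h5 hApos
  have h6 : (S.card : ℝ) * (κ * n ^ 3 / 4) ≤ n ^ 4 + S.card * n ^ 2 := by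
    calc (S.card : ℝ) * (κ * n ^ 3 / 4) = ∑ s ∈ S, (κ * n ^ 3 / 4) := by simp
      _ ≤ ∑ s ∈ S, (en A s : ℝ) := Finset.sum_le_sum h1
      _ ≤ n ^ 4 + S.card * n ^ 2 := by rw [hn]; exact_mod_cast en_sum A S
  have h7 : (S.card : ℝ) * n ^ 2 * 8 ≤ S.card * n ^ 2 * (κ * n) := by gcongr
  have h8 : n ^ 3 * (κ * S.card) ≤ n ^ 3 * (8 * n) := by nlinarith
  exact le_of_mul_le_mul_left h8 (by positivity)

theorem pl5 {A : Finset F} (hA : A.Nonempty) {D : ℝ} (hAA : ((A - A).card : ℝ) ≤ D * A.card) :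
    ((A + ((A - A) + (A - A))).card : ℝ) ≤ D ^ 5 * A.card := by
  have hApos : (0:ℝ) < A.card := by exact_mod_cast hA.card_pos
  have h := Finset.pluennecke_ruzsa_inequality_nsmul_sub_nsmul_sub hA A 3 2
  simp only [succ_nsmul, zero_nsmul, zero_add] at h
  have h' : ((A + A + A - (A + A)).card : ℝ) ≤ ((A - A).card / A.card : ℝ) ^ 5 * A.card := by
    have h2 := (NNRat.cast_le (K := ℝ)).2 h
    push_cast at h2
    exact h2
  have e : A + ((A - A) + (A - A)) = A + A + A - (A + A) := by
    simp only [sub_eq_add_neg, neg_add]; ac_rfl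
  rw [e]
  refine h'.trans ?_
  gcongr
  rwa [div_le_iff₀ hApos]

theorem pl7 {A : Finset F} (hA : A.Nonempty) {D : ℝ} (hAA : ((A - A).card : ℝ) ≤ D * A.card) :
    ((A + ((A - A) + (A - A) + (A - A))).card : ℝ) ≤ D ^ 7 * A.card := by
  have hApos : (0:ℝ) < A.card := by exact_mod_cast hA.card_pos
  have h := Finset.pluennecke_ruzsa_inequality_nsmul_sub_nsmul_sub hA A 4 3
  simp only [succ_nsmul, zero_nsmul, zero_add] at h
  have h' : ((A + A + A + A - (A + A + A)).card : ℝ) ≤ ((A - A).card / A.card : ℝ) ^ 7 * A.card := by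
    have h2 := (NNRat.cast_le (K := ℝ)).2 h
    push_cast at h2
    exact h2
  have e : A + ((A - A) + (A - A) + (A - A)) = A + A + A + A - (A + A + A) := by
    simp only [sub_eq_add_neg, neg_add]; ac_rfl
  rw [e]
  refine h'.trans ?_
  gcongr
  rwa [div_le_iff₀ hApos]

theorem Good.final {A : Finset F} (hA : A.Nonempty) {γ D : ℝ} (hγ : 0 < γ) (hD : 0 < D)
    {s : F} {n j : ℕ} {Q : Finset F} (h : Good A γ s n Q)
    (hQ : ((A + Q).card : ℝ) ≤ D ^ j * A.card) {κ : ℝ} (hκ : κ ≤ γ ^ n / (2 * D ^ j)) :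
    ∃ Y ⊆ A, (A.card : ℝ) ≤ 2 * Y.card ∧
      ((A + Y.image (fun y => s * y)).card : ℝ) * κ ≤ A.card := by
  obtain ⟨Y, hYA, hY, hc⟩ := h.cover hA hγ
  refine ⟨Y, hYA, hY, ?_⟩
  have hApos : (0:ℝ) < A.card := by exact_mod_cast hA.card_pos
  have hYc : (Y.card : ℝ) ≤ A.card := by exact_mod_cast Finset.card_le_card hYA
  have h1 : ((A + Y.image (fun y => s * y)).card : ℝ) * (γ ^ n * A.card)
      ≤ 2 * A.card * (D ^ j * A.card) := hc.trans (by gcongr)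
  have h2 : ((A + Y.image (fun y => s * y)).card : ℝ) * γ ^ n ≤ A.card * (2 * D ^ j) := by
    refine le_of_mul_le_mul_right ?_ hApos
    linarith
  calc ((A + Y.image (fun y => s * y)).card : ℝ) * κ
      ≤ (A + Y.image (fun y => s * y)).card * (γ ^ n / (2 * D ^ j)) := by gcongr
    _ = ((A + Y.image (fun y => s * y)).card * γ ^ n) / (2 * D ^ j) := by ring
    _ ≤ A.card := by rw [div_le_iff₀ (by positivity)]; exact h2

theorem not_quot_inj {T : Finset F} {ξ : F} (hξ : ξ ∉ quotSet T) {d : F} (hd : d ≠ 0) :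
    ((T ×ˢ T).image (fun p => d * (p.1 + ξ * p.2))).card = T.card ^ 2 := by
  rw [Finset.card_image_of_injOn, Finset.card_product, sq]
  rintro ⟨a, b⟩ hp ⟨a', b'⟩ hp' h
  simp only [Finset.coe_product, Set.mem_prod, Finset.mem_coe] at hp hp' h
  have h1 := mul_left_cancel₀ hd h
  by_cases hb : b = b'
  · subst hb
    rw [add_right_cancel h1]
  · exfalso
    apply hξ
    refine ⟨a', hp'.1, a, hp.1, b, hp.2, b', hp'.2, hb, ?_⟩
    rw [eq_div_iff (sub_ne_zero.2 hb)]
    linear_combination h1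

/-- `A` is approximately invariant under the dilates from `T`. -/
def Str (A T : Finset F) (β : ℝ) : Prop :=
  ∀ t ∈ T, ∃ W ⊆ A, β * A.card ≤ (W.card : ℝ) ∧ ∃ x, ∀ w ∈ W, ∃ a ∈ A, w = t * a + x

theorem Str.g2 {A T : Finset F} {β D : ℝ} (hS : Str A T β) (hA : A.Nonempty) (hβ : 0 ≤ β)
    (hD : 0 < D) (hAA : ((A - A).card : ℝ) ≤ D * A.card) {t t' : F} (ht : t ∈ T) (ht' : t' ∈ T) :
    Good A (β / D) (t * t') 2 A := by
  have := Good.comp hA hβ hD hAA (hS t ht)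
    (Good.comp hA hβ hD hAA (hS t' ht') (good_one A (β / D)))
  simpa using this

theorem Str.g3 {A T : Finset F} {β D : ℝ} (hS : Str A T β) (hA : A.Nonempty) (hβ : 0 ≤ β)
    (hD : 0 < D) (hAA : ((A - A).card : ℝ) ≤ D * A.card) {t t' t'' : F} (ht : t ∈ T) (ht' : t' ∈ T)
    (ht'' : t'' ∈ T) :
    Good A (β / D) (t * (t' * t'')) 3 A :=
  Good.comp hA hβ hD hAA (hS t ht) (hS.g2 hA hβ hD hAA ht' ht'')

theorem quot_subfield [Fintype F] (T : Finset F) (hT0 : ∀ t ∈ T, t ≠ 0) (hT : 2 ≤ T.card)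
    (h1 : ∀ r ∈ quotSet T, 1 + r ∈ quotSet T)
    (h2 : ∀ t ∈ T, ∀ r ∈ quotSet T, t * r ∈ quotSet T) :
    ∃ G : Subfield F, (∀ x, x ∈ G ↔ x ∈ quotSet T) ∧ ∀ t ∈ T, t ∈ G := by
  have hcard : 2 ≤ Fintype.card F := Fintype.one_lt_card
  have hinv : ∀ x : F, x ≠ 0 → x⁻¹ = x ^ (Fintype.card F - 2) := by
    intro x hx
    apply inv_eq_of_mul_eq_one_right
    rw [← pow_succ']
    have : Fintype.card F - 2 + 1 = Fintype.card F - 1 := by omega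
    rw [this]
    exact FiniteField.pow_card_sub_one_eq_one x hx
  let H : Set F := {x | ∀ r ∈ quotSet T, x + r ∈ quotSet T}
  have H0 : (0:F) ∈ H := fun r hr => by simpa using hr
  have H1 : (1:F) ∈ H := h1
  have Hadd : ∀ x ∈ H, ∀ y ∈ H, x + y ∈ H := fun x hx y hy r hr => by
    rw [add_assoc]; exact hx _ (hy _ hr)
  have Hns : ∀ x ∈ H, ∀ n : ℕ, n • x ∈ H := by
    intro x hx n
    induction n with
    | zero => simpa using H0
    | succ n ih => rw [succ_nsmul]; exact Hadd _ ih _ hx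
  have Hneg : ∀ x ∈ H, -x ∈ H := by
    intro x hx
    have : -x = (Fintype.card F - 1) • x := by
      rw [eq_comm, ← add_eq_zero_iff_eq_neg, ← succ_nsmul]
      have : Fintype.card F - 1 + 1 = Fintype.card F := by omega
      rw [this]
      exact card_nsmul_eq_zero
    rw [this]; exact Hns x hx _
  have HT : ∀ t ∈ T, ∀ h ∈ H, t * h ∈ H := by
    intro t ht h hh r hr
    have hpow : ∀ n : ℕ, t ^ n * r ∈ quotSet T := by
      intro n
      induction n with
      | zero => simpa using hr
      | succ n ih => rw [pow_succ', mul_assoc]; exact h2 t ht _ ih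
    have h3 : t⁻¹ * r ∈ quotSet T := by rw [hinv t (hT0 t ht)]; exact hpow _
    have h4 := h2 t ht _ (hh _ h3)
    rwa [mul_add, mul_inv_cancel_left₀ (hT0 t ht)] at h4
  have hmul : ∀ {a b : F}, a ∈ {x : F | ∀ h ∈ H, x * h ∈ H} → b ∈ {x : F | ∀ h ∈ H, x * h ∈ H} →
      a * b ∈ {x : F | ∀ h ∈ H, x * h ∈ H} := by
    intro a b ha hb h hh
    rw [mul_assoc]; exact ha _ (hb _ hh)
  have hone : (1:F) ∈ {x : F | ∀ h ∈ H, x * h ∈ H} := fun h hh => by simpa using hh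
  have hzero : (0:F) ∈ {x : F | ∀ h ∈ H, x * h ∈ H} := fun h hh => by simpa using H0
  let G : Subfield F :=
    { carrier := {x | ∀ h ∈ H, x * h ∈ H}
      mul_mem' := hmul
      one_mem' := hone
      zero_mem' := hzero
      add_mem' := by
        intro a b ha hb h hh
        rw [add_mul]; exact Hadd _ (ha _ hh) _ (hb _ hh)
      neg_mem' := by
        intro a ha h hh
        rw [neg_mul]; exact Hneg _ (ha _ hh)
      inv_mem' := by
        intro a ha
        by_cases h0 : a = 0
        · rw [h0, inv_zero]; exact hzero
        · rw [hinv a h0]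
          have : ∀ n : ℕ, a ^ n ∈ {x : F | ∀ h ∈ H, x * h ∈ H} := by
            intro n
            induction n with
            | zero => rw [pow_zero]; exact hone
            | succ n ih => rw [pow_succ]; exact hmul ih ha
          exact this _ }
  have hTG : ∀ t ∈ T, t ∈ G := HT
  refine ⟨G, fun x => ⟨fun hx => ?_, ?_⟩, hTG⟩
  · have hx1 : x * 1 ∈ H := hx 1 H1
    rw [mul_one] at hx1
    obtain ⟨a, ha, b, hb, hab⟩ := Finset.one_lt_card.1 hT
    have h0 : (0:F) ∈ quotSet T := ⟨a, ha, a, ha, a, ha, b, hb, hab, by simp⟩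
    simpa using hx1 0 h0
  · rintro ⟨a, ha, b, hb, c, hc, d, hd, hcd, rfl⟩
    exact G.div_mem (G.sub_mem (hTG a ha) (hTG b hb)) (G.sub_mem (hTG c hc) (hTG d hd))

theorem dichotomy [Fintype F] (A T : Finset F) (β D κ₀ κ₁ : ℝ) (hA : A.Nonempty)
    (hT0 : ∀ t ∈ T, t ≠ 0) (hT : 2 ≤ T.card) (hβ : 0 < β) (hD : 0 < D)
    (hAA : ((A - A).card : ℝ) ≤ D * A.card) (hS : Str A T β)
    (hκ₀ : κ₀ ≤ (β / D) ^ 8 / (2 * D ^ 5)) (hκ₁ : κ₁ ≤ (β / D) ^ 12 / (2 * D ^ 7))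
    (hκ₂ : κ₁ ≤ (β / D) ^ 10 / (2 * D ^ 5)) (hκ0 : 0 < κ₀) (hκ1 : 0 < κ₁)
    (hn0 : 8 ≤ κ₀ * A.card) (hn1 : 8 ≤ κ₁ * A.card) :
    κ₁ * (T.card : ℝ) ^ 2 ≤ 8 * A.card ∨
    ∃ G : Subfield F, (∀ t ∈ T, t ∈ G) ∧
      κ₀ * min ((T.card : ℝ) ^ 2) (Nat.card G) ≤ 16 * A.card := by
  have hγ : 0 < β / D := by positivity
  have G2 : ∀ {t t' : F}, t ∈ T → t' ∈ T → Good A (β / D) (t * t') 2 A :=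
    fun ht ht' => hS.g2 hA hβ.le hD hAA ht ht'
  by_cases h1 : ∀ r ∈ quotSet T, 1 + r ∈ quotSet T
  swap
  · left
    push Not at h1
    obtain ⟨r, ⟨a, ha, b, hb, c, hc, d, hd, hcd, rfl⟩, hr⟩ := h1
    have hcd' := sub_ne_zero.2 hcd
    have hi := not_quot_inj hr hcd'
    have := few_good (A := A) (hA := hA) (κ := κ₁) (hκ := hκ1) (hκn := hn1) (S := (T ×ˢ T).image
      (fun p => (c - d) * (p.1 + (1 + (a - b) / (c - d)) * p.2))) (by
      intro s hs
      obtain ⟨⟨u, v⟩, huv, rfl⟩ := Finset.mem_image.1 hs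
      rw [Finset.mem_product] at huv
      obtain ⟨hu, hv⟩ := huv
      have g := ((Good.sub hγ.le (G2 hc hu) (G2 hd hu)).add hγ.le
        (Good.sub hγ.le (G2 hc hv) (G2 hd hv))).add hγ.le (Good.sub hγ.le (G2 ha hv) (G2 hb hv))
      have e : (c - d) * (u + (1 + (a - b) / (c - d)) * v) =
          c * u - d * u + (c * v - d * v) + (a * v - b * v) := by field_simp; ring
      simp only [e]
      exact g.final hA hγ hD (pl7 hA hAA) hκ₁)
    rw [hi] at this
    exact_mod_cast this
  by_cases h2 : ∀ t ∈ T, ∀ r ∈ quotSet T, t * r ∈ quotSet T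
  swap
  · left
    push Not at h2
    obtain ⟨t, ht, r, ⟨a, ha, b, hb, c, hc, d, hd, hcd, rfl⟩, hr⟩ := h2
    have hcd' := sub_ne_zero.2 hcd
    have hi := not_quot_inj hr hcd'
    have := few_good (A := A) (hA := hA) (κ := κ₁) (hκ := hκ1) (hκn := hn1) (S := (T ×ˢ T).image
      (fun p => (c - d) * (p.1 + (t * ((a - b) / (c - d))) * p.2))) (by
      intro s hs
      obtain ⟨⟨u, v⟩, huv, rfl⟩ := Finset.mem_image.1 hs
      rw [Finset.mem_product] at huv
      obtain ⟨hu, hv⟩ := huv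
      have g := (Good.sub hγ.le (G2 hc hu) (G2 hd hu)).add hγ.le
        (Good.sub hγ.le (hS.g3 hA hβ.le hD hAA ht ha hv) (hS.g3 hA hβ.le hD hAA ht hb hv))
      have e : (c - d) * (u + (t * ((a - b) / (c - d))) * v) =
          c * u - d * u + (t * (a * v) - t * (b * v)) := by field_simp
      simp only [e]
      exact g.final hA hγ hD (pl5 hA hAA) hκ₂)
    rw [hi] at this
    exact_mod_cast this
  right
  obtain ⟨G, hG, hTG⟩ := quot_subfield T hT0 hT h1 h2
  refine ⟨G, hTG, ?_⟩
  let Gf : Finset F := Finset.univ.filter (fun x => x ∈ G)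
  have hGf : Nat.card G = Gf.card := by
    rw [Nat.card_eq_fintype_card]
    exact Fintype.card_subtype _
  have hGne : Gf.Nonempty := ⟨0, by simp [Gf]⟩
  have hes := en_sum T Gf
  obtain ⟨ξ, hξ, hle⟩ : ∃ ξ ∈ Gf, (Gf.card : ℝ) * (en T ξ : ℝ) ≤ T.card ^ 4 + Gf.card * T.card ^ 2 := by
    by_contra hcon
    push Not at hcon
    have h3 := Finset.sum_lt_sum_of_nonempty hGne hcon
    rw [Finset.sum_const, nsmul_eq_mul, ← Finset.mul_sum] at h3
    have h4 : (∑ s ∈ Gf, (en T s : ℝ)) ≤ T.card ^ 4 + Gf.card * T.card ^ 2 := by exact_mod_cast hes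
    have h5 : (0:ℝ) < Gf.card := by exact_mod_cast hGne.card_pos
    exact absurd h4 (not_le.2 (lt_of_mul_lt_mul_left h3 h5.le))
  have hξG : ξ ∈ G := by simpa [Gf] using hξ
  obtain ⟨a, ha, b, hb, c, hc, d, hd, hcd, hξe⟩ := (hG ξ).1 hξG
  have hcd' := sub_ne_zero.2 hcd
  have hfew := few_good (A := A) (hA := hA) (κ := κ₀) (hκ := hκ0) (hκn := hn0) (S := (T ×ˢ T).image
      (fun p => (c - d) * (p.1 + ξ * p.2))) (by
      intro s hs
      obtain ⟨⟨u, v⟩, huv, rfl⟩ := Finset.mem_image.1 hs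
      rw [Finset.mem_product] at huv
      obtain ⟨hu, hv⟩ := huv
      have g := (Good.sub hγ.le (G2 hc hu) (G2 hd hu)).add hγ.le
        (Good.sub hγ.le (G2 ha hv) (G2 hb hv))
      have e : (c - d) * (u + ξ * v) =
          c * u - d * u + (a * v - b * v) := by rw [hξe]; field_simp
      simp only [e]
      exact g.final hA hγ hD (pl5 hA hAA) hκ₀)
  set S := (T ×ˢ T).image (fun p => (c - d) * (p.1 + ξ * p.2)) with hSdef
  have hlow : ((T.card : ℝ) * T.card) ^ 2 ≤ S.card * en T ξ := by
    have h := card_sq_le_fiber (T ×ˢ T) (fun p : F × F => (c - d) * (p.1 + ξ * p.2))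
    rw [Finset.card_product] at h
    push_cast at h
    refine h.trans (le_of_eq ?_)
    congr 2
    unfold en
    congr 1
    ext p
    simp only [Finset.mem_filter, mul_right_inj' hcd']
  rw [hGf]
  set g : ℝ := (Gf.card : ℝ) with hg
  set τ : ℝ := (T.card : ℝ) with hτ
  set N : ℝ := (S.card : ℝ) with hN
  have hgpos : 0 < g := by rw [hg]; exact_mod_cast hGne.card_pos
  have hτpos : 0 < τ := by rw [hτ]; exact_mod_cast (by omega : 0 < T.card)
  have hNpos : 0 ≤ N := by rw [hN]; positivity
  have h6 : g * (τ * τ) ^ 2 ≤ N * (τ ^ 4 + g * τ ^ 2) := by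
    calc g * (τ * τ) ^ 2 ≤ g * (N * en T ξ) := by gcongr
      _ = N * (g * en T ξ) := by ring
      _ ≤ _ := by gcongr
  have h7 : min (τ ^ 2) g ≤ 2 * N := by
    have h8 : g * τ ^ 2 ≤ N * (τ ^ 2 + g) := by
      refine le_of_mul_le_mul_left ?_ (by positivity : 0 < τ ^ 2)
      linarith
    rcases le_total (τ ^ 2) g with hc | hc
    · rw [min_eq_left hc]
      refine le_of_mul_le_mul_left ?_ hgpos
      nlinarith
    · rw [min_eq_right hc]
      refine le_of_mul_le_mul_left ?_ (by positivity : 0 < τ ^ 2)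
      nlinarith
  calc κ₀ * min (τ ^ 2) g ≤ κ₀ * (2 * N) := by gcongr
    _ ≤ _ := by linarith

/-- number of rows `b ∈ B` at which the line `x = l.1 * y + l.2` hits `A`. -/
def rr (A B : Finset F) (l : F × F) : ℕ := (B.filter (fun b => l.1 * b + l.2 ∈ A)).card

theorem lines_le [Fintype F] (A B : Finset F) :
    (Finset.univ.filter (fun l : F × F => 2 ≤ rr A B l)).card ≤ numLines (A ×ˢ B) := by
  unfold numLines
  rw [← Set.ncard_coe_finset]
  refine Set.ncard_le_ncard_of_injOn (fun l : F × F => {p : F × F | 1 * p.1 + (-l.1) * p.2 = l.2})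
    ?_ ?_ (Set.toFinite _)
  · intro l hl
    simp only [Finset.coe_filter, Finset.mem_univ, true_and, Set.mem_ofPred_eq] at hl
    refine ⟨⟨1, -l.1, l.2, by simp, rfl⟩, hl.trans ?_⟩
    refine Finset.card_le_card_of_injOn (fun b => (l.1 * b + l.2, b)) ?_ ?_
    · intro b hb
      simp only [Finset.coe_filter, Set.mem_ofPred_eq, Finset.mem_product] at hb ⊢
      refine ⟨⟨hb.2, hb.1⟩, ?_⟩
      ring
    · intro b _ b' _ h
      exact (Prod.ext_iff.1 h).2
  · rintro ⟨m, k⟩ _ ⟨m', k'⟩ _ h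
    simp only [] at h
    have h1 : ((k, 0) : F × F) ∈ {p : F × F | 1 * p.1 + (-m) * p.2 = k} := by
      simp only [Set.mem_ofPred_eq]; ring
    have h2 : ((m + k, 1) : F × F) ∈ {p : F × F | 1 * p.1 + (-m) * p.2 = k} := by
      simp only [Set.mem_ofPred_eq]; ring
    rw [h] at h1 h2
    simp only [Set.mem_ofPred_eq] at h1 h2
    have hk : k = k' := by linear_combination h1
    have hm : m = m' := by linear_combination h2 - hk
    rw [hk, hm]

theorem pair_count [Fintype F] (A : Finset F) {b b' : F} (h : b ≠ b') :
    A.card ^ 2 ≤ (Finset.univ.filter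
      (fun l : F × F => l.1 * b + l.2 ∈ A ∧ l.1 * b' + l.2 ∈ A)).card := by
  rw [sq, ← Finset.card_product]
  have hb := sub_ne_zero.2 h
  refine Finset.card_le_card_of_injOn
    (fun p : F × F => ((p.1 - p.2) / (b - b'), p.1 - (p.1 - p.2) / (b - b') * b)) ?_ ?_
  · rintro ⟨u, v⟩ hp
    simp only [Finset.coe_product, Set.mem_prod, Finset.mem_coe] at hp
    simp only [Finset.coe_filter, Finset.mem_univ, true_and, Set.mem_ofPred_eq]
    have e1 : (u - v) / (b - b') * b + (u - (u - v) / (b - b') * b) = u := by ring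
    have e2 : (u - v) / (b - b') * b' + (u - (u - v) / (b - b') * b) = v := by
      field_simp; ring
    rw [e1, e2]; exact hp
  · rintro ⟨u, v⟩ _ ⟨u', v'⟩ _ h
    simp only [Prod.mk.injEq] at h
    obtain ⟨h1, h2⟩ := h
    rw [h1] at h2
    have hu : u = u' := sub_left_injective h2
    rw [div_left_inj' hb] at h1
    have hv : v = v' := by linear_combination hu - h1
    rw [hu, hv]

/-- number of pairs of `A` whose affine combination with parameter `t` is again in `A`. -/
def Nt (A : Finset F) (t : F) : ℕ :=
  ((A ×ˢ A).filter (fun p => p.1 + t * (p.2 - p.1) ∈ A)).card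

theorem triple_le [Fintype F] (A : Finset F) {b0 b1 b2 : F} (h : b1 ≠ b0) :
    (Finset.univ.filter (fun l : F × F => l.1 * b0 + l.2 ∈ A ∧ l.1 * b1 + l.2 ∈ A ∧
      l.1 * b2 + l.2 ∈ A)).card ≤ Nt A ((b2 - b0) / (b1 - b0)) := by
  have hb := sub_ne_zero.2 h
  refine Finset.card_le_card_of_injOn (fun l : F × F => (l.1 * b0 + l.2, l.1 * b1 + l.2)) ?_ ?_
  · rintro ⟨m, k⟩ hl
    simp only [Finset.coe_filter, Finset.mem_univ, true_and, Set.mem_ofPred_eq,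
      Finset.mem_product] at hl ⊢
    refine ⟨⟨hl.1, hl.2.1⟩, ?_⟩
    have e : m * b0 + k + (b2 - b0) / (b1 - b0) * (m * b1 + k - (m * b0 + k)) = m * b2 + k := by
      field_simp; ring
    rw [e]; exact hl.2.2
  · rintro ⟨m, k⟩ _ ⟨m', k'⟩ _ h
    simp only [Prod.mk.injEq] at h
    have hm : m = m' := by
      have : (m - m') * (b1 - b0) = 0 := by linear_combination h.2 - h.1
      rcases mul_eq_zero.1 this with h | h
      · exact sub_eq_zero.1 h
      · exact absurd h hb
    subst hm
    rw [add_left_cancel h.1]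

theorem pointwise (r : ℕ) (ρ : ℝ) (hρ : 0 < ρ) :
    ρ * ((r : ℝ) * (r - 1)) - (if 2 ≤ r then ρ ^ 3 else 0) ≤ (r : ℝ) * (r - 1) ^ 2 := by
  split_ifs with h
  · obtain ⟨x, hx⟩ : ∃ x : ℝ, x = (r : ℝ) - 1 := ⟨_, rfl⟩
    have h2 : (2:ℝ) ≤ r := by exact_mod_cast h
    have hx1 : 1 ≤ x := by linarith
    have hr : (r : ℝ) = x + 1 := by linarith
    rw [← hx, hr]
    rcases le_total ρ x with hc | hc
    · have : ρ * ((x + 1) * x) ≤ x * ((x + 1) * x) := by gcongr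
      nlinarith [pow_pos hρ 3]
    · have h3 : (x + 1) * x * (ρ - x) ≤ (2 * x) * x * (ρ - x) := by
        have : 0 ≤ ρ - x := by linarith
        gcongr; linarith
      have h4 : 0 ≤ (ρ - x) ^ 2 * (ρ + 2 * x) + ρ * x ^ 2 := by positivity
      nlinarith
  · have : r = 0 ∨ r = 1 := by omega
    rcases this with h | h <;> simp [h]

theorem sum_pairs [Fintype F] (A B : Finset F) :
    (A.card : ℝ) ^ 2 * ((B.card : ℝ) * (B.card - 1)) ≤
      ∑ l : F × F, (rr A B l : ℝ) * (rr A B l - 1) := by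
  have h1 : ∀ l : F × F, (rr A B l : ℝ) * (rr A B l - 1) =
      ∑ p ∈ B.offDiag, if l.1 * p.1 + l.2 ∈ A ∧ l.1 * p.2 + l.2 ∈ A then (1:ℝ) else 0 := by
    intro l
    rw [← Finset.sum_filter, Finset.sum_const, nsmul_eq_mul, mul_one]
    have : B.offDiag.filter (fun p => l.1 * p.1 + l.2 ∈ A ∧ l.1 * p.2 + l.2 ∈ A) =
        (B.filter (fun b => l.1 * b + l.2 ∈ A)).offDiag := by
      ext p
      simp only [Finset.mem_filter, Finset.mem_offDiag]
      tauto
    rw [this, Finset.offDiag_card, Nat.cast_sub (Nat.le_mul_self _)]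
    unfold rr
    push_cast; ring
  simp only [h1]
  rw [Finset.sum_comm]
  have h2 : ∀ p ∈ B.offDiag, (A.card : ℝ) ^ 2 ≤
      ∑ l : F × F, if l.1 * p.1 + l.2 ∈ A ∧ l.1 * p.2 + l.2 ∈ A then (1:ℝ) else 0 := by
    intro p hp
    rw [Finset.mem_offDiag] at hp
    rw [← Finset.sum_filter, Finset.sum_const, nsmul_eq_mul, mul_one]
    exact_mod_cast pair_count A hp.2.2
  refine le_trans (le_of_eq ?_) (Finset.sum_le_sum h2)
  rw [Finset.sum_const, nsmul_eq_mul, Finset.offDiag_card, Nat.cast_sub (Nat.le_mul_self _)]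
  push_cast; ring

theorem sum_triples [Fintype F] (A B : Finset F) :
    ∑ l : F × F, (rr A B l : ℝ) * (rr A B l - 1) ^ 2 ≤
      ∑ b0 ∈ B, ∑ b1 ∈ B.erase b0, ∑ b2 ∈ B.erase b0, (Nt A ((b2 - b0) / (b1 - b0)) : ℝ) := by
  let I : F × F → F → ℝ := fun l b => if l.1 * b + l.2 ∈ A then 1 else 0
  have hr : ∀ l, (rr A B l : ℝ) = ∑ b ∈ B, I l b := by
    intro l
    simp only [I, rr]
    rw [← Finset.sum_filter, Finset.sum_const, nsmul_eq_mul, mul_one]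
  have h1 : ∀ l : F × F, (rr A B l : ℝ) * (rr A B l - 1) ^ 2 =
      ∑ b0 ∈ B, ∑ b1 ∈ B.erase b0, ∑ b2 ∈ B.erase b0, I l b0 * (I l b1 * I l b2) := by
    intro l
    conv_lhs => rw [hr l, Finset.sum_mul]
    refine Finset.sum_congr rfl fun b0 hb0 => ?_
    have e : ∑ b1 ∈ B.erase b0, ∑ b2 ∈ B.erase b0, I l b0 * (I l b1 * I l b2) =
        I l b0 * (∑ b ∈ B.erase b0, I l b) ^ 2 := by
      rw [sq, Finset.sum_mul_sum, Finset.mul_sum]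
      refine Finset.sum_congr rfl fun b1 _ => ?_
      rw [Finset.mul_sum]
    rw [e, ← Finset.add_sum_erase B _ hb0]
    by_cases h : l.1 * b0 + l.2 ∈ A
    · have : I l b0 = 1 := by simp [I, h]
      rw [this]; ring
    · have : I l b0 = 0 := by simp [I, h]
      rw [this]; ring
  simp only [h1]
  rw [Finset.sum_comm]
  refine Finset.sum_le_sum fun b0 hb0 => ?_
  rw [Finset.sum_comm]
  refine Finset.sum_le_sum fun b1 hb1 => ?_
  rw [Finset.sum_comm]
  refine Finset.sum_le_sum fun b2 hb2 => ?_
  have h2 : ∀ l : F × F, I l b0 * (I l b1 * I l b2) =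
      if (l.1 * b0 + l.2 ∈ A ∧ l.1 * b1 + l.2 ∈ A ∧ l.1 * b2 + l.2 ∈ A) then (1:ℝ) else 0 := by
    intro l
    simp only [I]
    split_ifs <;> simp_all
  simp only [h2]
  rw [← Finset.sum_filter, Finset.sum_const, nsmul_eq_mul, mul_one]
  exact_mod_cast triple_le A (Finset.ne_of_mem_erase hb1)

theorem exists_T0 [Fintype F] (A B : Finset F) (hB : 2 ≤ B.card) (hA : A.Nonempty) (L δ : ℝ) (hδ : 0 < δ)
    (hL : ((Finset.univ.filter (fun l : F × F => 2 ≤ rr A B l)).card : ℝ) ≤ L)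
    (hδL : δ ^ 2 * L ≤ (A.card : ℝ) ^ 2) :
    ∃ T0 : Finset F, T0.card ≤ B.card ∧ (∀ t ∈ T0, t ≠ 0) ∧
      (∃ b0 b1 : F, b1 ≠ b0 ∧ ∀ t ∈ T0, ∃ b ∈ B, t = (b - b0) / (b1 - b0)) ∧
      (B.card : ℝ) * δ / 4 * (A.card : ℝ) ^ 2 ≤ ∑ t ∈ T0, (Nt A t : ℝ) := by
  set m : ℝ := (B.card : ℝ) with hm
  set n : ℝ := (A.card : ℝ) with hn
  have hm2 : 2 ≤ m := by rw [hm]; exact_mod_cast hB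
  have hnpos : 0 < n := by rw [hn]; exact_mod_cast hA.card_pos
  have hρ : 0 < m * δ / 2 := by positivity
  have hsum : ∑ l : F × F, ((m * δ / 2) * ((rr A B l : ℝ) * (rr A B l - 1)) -
      (if 2 ≤ rr A B l then (m * δ / 2) ^ 3 else 0)) ≤
      ∑ l : F × F, (rr A B l : ℝ) * (rr A B l - 1) ^ 2 :=
    Finset.sum_le_sum fun l _ => pointwise _ _ hρ
  rw [Finset.sum_sub_distrib, ← Finset.mul_sum, ← Finset.sum_filter, Finset.sum_const,
    nsmul_eq_mul] at hsum
  have hp := sum_pairs A B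
  rw [← hm, ← hn] at hp
  have h3 : (m * δ / 2) ^ 3 * L ≤ m * δ / 4 * (n ^ 2 * (m * (m - 1))) := by
    have : (m * δ / 2) ^ 3 * L = m * δ / 2 * (m ^ 2 / 4 * (δ ^ 2 * L)) := by ring
    rw [this]
    calc m * δ / 2 * (m ^ 2 / 4 * (δ ^ 2 * L)) ≤ m * δ / 2 * (m ^ 2 / 4 * n ^ 2) := by gcongr
      _ = m * δ / 2 * (n ^ 2 * (m * (m / 4))) := by ring
      _ ≤ m * δ / 2 * (n ^ 2 * (m * ((m - 1) / 2))) := by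
        have h25 : m / 4 ≤ (m - 1) / 2 := by linarith
        have h26 : 0 ≤ m := by linarith
        exact mul_le_mul_of_nonneg_left (mul_le_mul_of_nonneg_left
          (mul_le_mul_of_nonneg_left h25 h26) (by positivity)) hρ.le
      _ = _ := by ring
  have hbig : m * δ / 4 * (n ^ 2 * (m * (m - 1))) ≤
      ∑ b0 ∈ B, ∑ b1 ∈ B.erase b0, ∑ b2 ∈ B.erase b0, (Nt A ((b2 - b0) / (b1 - b0)) : ℝ) := by
    refine le_trans ?_ (sum_triples A B)
    refine le_trans ?_ hsum
    have h4 : m * δ / 2 * (n ^ 2 * (m * (m - 1))) ≤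
      m * δ / 2 * ∑ l : F × F, (rr A B l : ℝ) * (rr A B l - 1) := by gcongr
    have h5 : ((Finset.univ.filter (fun l : F × F => 2 ≤ rr A B l)).card : ℝ) * (m * δ / 2) ^ 3
      ≤ L * (m * δ / 2) ^ 3 := by gcongr
    linarith
  obtain ⟨b0, hb0, b1, hb1, hb⟩ : ∃ b0 ∈ B, ∃ b1 ∈ B.erase b0, m * δ / 4 * n ^ 2 ≤
      ∑ b2 ∈ B.erase b0, (Nt A ((b2 - b0) / (b1 - b0)) : ℝ) := by
    by_contra hcon
    push Not at hcon
    have hBne : B.Nonempty := Finset.card_pos.1 (by omega)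
    have : ∑ b0 ∈ B, ∑ b1 ∈ B.erase b0, ∑ b2 ∈ B.erase b0, (Nt A ((b2 - b0) / (b1 - b0)) : ℝ)
        < ∑ b0 ∈ B, ∑ b1 ∈ B.erase b0, m * δ / 4 * n ^ 2 := by
      refine Finset.sum_lt_sum_of_nonempty hBne fun b0 hb0 => ?_
      refine Finset.sum_lt_sum_of_nonempty ?_ fun b1 hb1 => hcon b0 hb0 b1 hb1
      rw [← Finset.card_pos, Finset.card_erase_of_mem hb0]; omega
    have e : ∑ b0 ∈ B, ∑ b1 ∈ B.erase b0, m * δ / 4 * n ^ 2 =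
        m * δ / 4 * (n ^ 2 * (m * (m - 1))) := by
      have : ∀ b0 ∈ B, ∑ b1 ∈ B.erase b0, m * δ / 4 * n ^ 2 = (m - 1) * (m * δ / 4 * n ^ 2) := by
        intro b0 hb0
        rw [Finset.sum_const, nsmul_eq_mul, Finset.card_erase_of_mem hb0, Nat.cast_sub (by omega)]
        simp [hm]
      rw [Finset.sum_congr rfl this, Finset.sum_const, nsmul_eq_mul, ← hm]
      ring
    rw [e] at this
    exact absurd hbig (not_le.2 this)
  have hne := Finset.ne_of_mem_erase hb1
  have hsub := sub_ne_zero.2 hne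
  have hinj : Set.InjOn (fun b => (b - b0) / (b1 - b0)) (B.erase b0 : Finset F) := by
    intro b _ b' _ h
    simp only [div_left_inj' hsub] at h
    exact sub_left_injective h
  refine ⟨(B.erase b0).image (fun b => (b - b0) / (b1 - b0)), ?_, ?_, ⟨b0, b1, hne, ?_⟩, ?_⟩
  · exact Finset.card_image_le.trans (Finset.card_le_card (Finset.erase_subset _ _))
  · intro t ht
    obtain ⟨b, hb, rfl⟩ := Finset.mem_image.1 ht
    exact div_ne_zero (sub_ne_zero.2 (Finset.ne_of_mem_erase hb)) hsub
  · intro t ht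
    obtain ⟨b, hb, rfl⟩ := Finset.mem_image.1 ht
    exact ⟨b, Finset.mem_of_mem_erase hb, rfl⟩
  · rw [Finset.sum_image hinj]
    exact hb

/-- Graph-theoretic part of Balog-Szemeredi-Gowers. -/
theorem bsg_graph (A : Finset F) (R : F → F → Prop) (a : ℝ) (ha : 0 < a)
    (hA : A.Nonempty)
    (hR : a * (A.card : ℝ) ^ 2 ≤ (((A ×ˢ A).filter (fun p => R p.1 p.2)).card : ℝ)) :
    ∃ A' ⊆ A, ∃ A'' ⊆ A', a ^ 2 * (A.card : ℝ) ^ 2 ≤ 2 * (A'.card : ℝ) ^ 2 ∧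
      3 / 4 * (A'.card : ℝ) ≤ A''.card ∧ 
      ∀ u ∈ A'', 4 * ((A'.filter (fun c => ((A.filter (fun v => R u v ∧ R c v)).card : ℝ) <
        a ^ 2 * A.card / 32)).card : ℝ) ≤ A'.card := by
  set n : ℝ := (A.card : ℝ) with hn
  have hnpos : 0 < n := by rw [hn]; exact_mod_cast hA.card_pos
  set bad : F → F → Prop := fun u c => ((A.filter (fun v => R u v ∧ R c v)).card : ℝ) <
        a ^ 2 * n / 32 with hbad
  set N : F → Finset F := fun v => A.filter (fun u => R u v) with hN
  have h1 : (((A ×ˢ A).filter (fun p => R p.1 p.2)).card : ℝ) = ∑ v ∈ A, ((N v).card : ℝ) := by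
    rw [← Nat.cast_sum, Finset.card_filter, Finset.sum_product_right]
    simp only [hN, Finset.card_filter]
  have h2 : a ^ 2 * n ^ 3 ≤ ∑ v ∈ A, ((N v).card : ℝ) ^ 2 := by
    have hc := sq_sum_le_card_mul_sum_sq (s := A) (f := fun v => ((N v).card : ℝ))
    rw [← h1, ← hn] at hc
    have : (a * n ^ 2) ^ 2 ≤ (((A ×ˢ A).filter (fun p => R p.1 p.2)).card : ℝ) ^ 2 := by gcongr
    have h3 : n * (a ^ 2 * n ^ 3) ≤ n * ∑ v ∈ A, ((N v).card : ℝ) ^ 2 := by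
      calc n * (a ^ 2 * n ^ 3) = (a * n ^ 2) ^ 2 := by ring
        _ ≤ _ := this.trans hc
    exact le_of_mul_le_mul_left h3 hnpos
  have h4 : ∑ v ∈ A, (((N v ×ˢ N v).filter (fun p => bad p.1 p.2)).card : ℝ) ≤
      a ^ 2 * n / 32 * n ^ 2 := by
    have e : ∑ v ∈ A, (((N v ×ˢ N v).filter (fun p => bad p.1 p.2)).card : ℝ) =
        ∑ p ∈ (A ×ˢ A).filter (fun p => bad p.1 p.2),
          ((A.filter (fun v => R p.1 v ∧ R p.2 v)).card : ℝ) := by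
      rw [← Nat.cast_sum, ← Nat.cast_sum]
      congr 1
      have := Finset.sum_card_bipartiteAbove_eq_sum_card_bipartiteBelow (s := A)
        (t := (A ×ˢ A).filter (fun p : F × F => bad p.1 p.2))
        (fun v p => R p.1 v ∧ R p.2 v)
      simp only [Finset.bipartiteAbove, Finset.bipartiteBelow] at this
      rw [← this]
      refine Finset.sum_congr rfl fun v _ => ?_
      congr 1
      ext p
      simp only [hN, Finset.mem_filter, Finset.mem_product]
      tauto
    rw [e]
    calc _ ≤ ∑ p ∈ (A ×ˢ A).filter (fun p => bad p.1 p.2), a ^ 2 * n / 32 := by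
          refine Finset.sum_le_sum fun p hp => ?_
          exact (Finset.mem_filter.1 hp).2.le
      _ = (((A ×ˢ A).filter (fun p => bad p.1 p.2)).card : ℝ) * (a ^ 2 * n / 32) := by
          rw [Finset.sum_const, nsmul_eq_mul]
      _ ≤ n ^ 2 * (a ^ 2 * n / 32) := by
          gcongr
          have hcf : ((A ×ˢ A).filter (fun p => bad p.1 p.2)).card ≤ A.card * A.card := by
            rw [← Finset.card_product]; exact Finset.card_filter_le _ _
          have hcf' : (((A ×ˢ A).filter (fun p => bad p.1 p.2)).card : ℝ) ≤ n * n := by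
            have := (Nat.cast_le (α := ℝ)).2 hcf
            rwa [Nat.cast_mul] at this
          exact hcf'.trans (sq n).ge
      _ = _ := by ring
  obtain ⟨v, hv, hv2⟩ : ∃ v ∈ A, a ^ 2 * n ^ 2 / 2 ≤ ((N v).card : ℝ) ^ 2 -
      16 * (((N v ×ˢ N v).filter (fun p => bad p.1 p.2)).card : ℝ) := by
    refine Finset.exists_le_of_sum_le hA ?_
    rw [Finset.sum_const, nsmul_eq_mul, Finset.sum_sub_distrib, ← Finset.mul_sum, ← hn]
    nlinarith
  set A' := N v with hA'
  have hb0 : (0:ℝ) ≤ (((A' ×ˢ A').filter (fun p => bad p.1 p.2)).card : ℝ) := Nat.cast_nonneg _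
  set k : ℝ := (A'.card : ℝ) with hk
  have hk1 : a ^ 2 * n ^ 2 ≤ 2 * k ^ 2 := by linarith
  have hkpos : 0 < k := by
    have : 0 < a ^ 2 * n ^ 2 := by positivity
    have h0 : 0 ≤ k := Nat.cast_nonneg _
    rcases h0.eq_or_lt with h | h
    · rw [← h] at hk1; norm_num at hk1; linarith
    · exact h
  refine ⟨A', Finset.filter_subset _ _,
    A'.filter (fun u => 4 * ((A'.filter (fun c => bad u c)).card : ℝ) ≤ k),
    Finset.filter_subset _ _, hk1, ?_, ?_⟩
  · have hs : (((A' ×ˢ A').filter (fun p => bad p.1 p.2)).card : ℝ) =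
        ∑ u ∈ A', ((A'.filter (fun c => bad u c)).card : ℝ) := by
      rw [← Nat.cast_sum, Finset.card_filter, Finset.sum_product]
      simp only [Finset.card_filter]
    have hs2 : ∑ u ∈ A'.filter (fun u => ¬ 4 * ((A'.filter (fun c => bad u c)).card : ℝ) ≤ k),
        k / 4 ≤ ∑ u ∈ A', ((A'.filter (fun c => bad u c)).card : ℝ) := by
      refine le_trans (Finset.sum_le_sum fun u hu => ?_)
        (Finset.sum_le_sum_of_subset_of_nonneg (Finset.filter_subset _ _)
          fun _ _ _ => Nat.cast_nonneg _)
      have := (Finset.mem_filter.1 hu).2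
      linarith
    rw [Finset.sum_const, nsmul_eq_mul, ← hs] at hs2
    have hc := Finset.card_filter_add_card_filter_not (s := A')
      (fun u => 4 * ((A'.filter (fun c => bad u c)).card : ℝ) ≤ k)
    have hc' : ((A'.filter (fun u => 4 * ((A'.filter (fun c => bad u c)).card : ℝ) ≤ k)).card : ℝ)
      + ((A'.filter (fun u => ¬ 4 * ((A'.filter (fun c => bad u c)).card : ℝ) ≤ k)).card : ℝ) = k :=
      by rw [← Nat.cast_add, hc]
    have hlast : ((A'.filter (fun u => ¬ 4 * ((A'.filter
        (fun c => bad u c)).card : ℝ) ≤ k)).card : ℝ) ≤ k / 4 := by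
      have : ((A'.filter (fun u => ¬ 4 * ((A'.filter
        (fun c => bad u c)).card : ℝ) ≤ k)).card : ℝ) * (k / 4) ≤ k / 4 * (k / 4) := by
        have : 0 ≤ a ^ 2 * n ^ 2 := by positivity
        nlinarith
      exact le_of_mul_le_mul_right this (by positivity)
    linarith
  · intro u hu
    exact (Finset.mem_filter.1 hu).2

theorem bsg (A : Finset F) (t : F) (ht0 : t ≠ 0) (ht1 : t ≠ 1) (a : ℝ) (ha : 0 < a)
    (hA : A.Nonempty) (hN : a * (A.card : ℝ) ^ 2 ≤ (Nt A t : ℝ)) :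
    ∃ A₁ ⊆ A, a / 2 * A.card ≤ (A₁.card : ℝ) ∧
      ((A₁ - A₁).card : ℝ) * a ^ 5 ≤ 4096 * A.card := by
  obtain ⟨A', hA', A'', hA'', hk1, hk2, hgood⟩ :=
    bsg_graph A (fun u v => u + t * (v - u) ∈ A) a ha hA (by unfold Nt at hN; convert hN)
  set n : ℝ := (A.card : ℝ) with hn
  have hnpos : 0 < n := by rw [hn]; exact_mod_cast hA.card_pos
  set k : ℝ := (A'.card : ℝ) with hk
  have hk0 : 0 ≤ k := Nat.cast_nonneg _
  have hkn : a * n / 2 ≤ k := by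
    refine le_of_sq_le_sq ?_ hk0
    nlinarith [sq_nonneg (a * n)]
  have hkn' : a / 2 * n ≤ 3 / 4 * k := by
    refine le_of_sq_le_sq ?_ (by positivity)
    nlinarith [sq_nonneg (a * n)]
  have hkpos : 0 < k := lt_of_lt_of_le (by positivity) hkn
  refine ⟨A'', hA''.trans hA', hkn'.trans hk2, ?_⟩
  set θ : ℝ := a ^ 2 * n / 32 with hθ
  have hθ0 : 0 < θ := by positivity
  set P : Finset F := (A - A).filter
    (fun z => θ ≤ (((A ×ˢ A).filter (fun p => p.1 - p.2 = z)).card : ℝ)) with hP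
  have hPc : (P.card : ℝ) * θ ≤ n ^ 2 := by
    have h := Finset.card_eq_sum_card_fiberwise (s := A ×ˢ A) (t := A - A)
      (f := fun p : F × F => p.1 - p.2) (by
        intro p hp
        simp only [Finset.coe_product, Set.mem_prod, Finset.mem_coe] at hp
        exact Finset.mem_coe.2 (Finset.sub_mem_sub hp.1 hp.2))
    rw [Finset.card_product] at h
    calc (P.card : ℝ) * θ = ∑ z ∈ P, θ := by rw [Finset.sum_const, nsmul_eq_mul]
      _ ≤ ∑ z ∈ P, (((A ×ˢ A).filter (fun p => p.1 - p.2 = z)).card : ℝ) :=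
          Finset.sum_le_sum fun z hz => (Finset.mem_filter.1 hz).2
      _ ≤ ∑ z ∈ A - A, (((A ×ˢ A).filter (fun p => p.1 - p.2 = z)).card : ℝ) :=
          Finset.sum_le_sum_of_subset_of_nonneg (Finset.filter_subset _ _)
            fun _ _ _ => Nat.cast_nonneg _
      _ = n ^ 2 := by
          rw [hn, sq, ← Nat.cast_mul, h, Nat.cast_sum]
  have hPmem : ∀ u c, θ ≤ ((A.filter (fun v => u + t * (v - u) ∈ A ∧
      c + t * (v - c) ∈ A)).card : ℝ) → (1 - t) * (u - c) ∈ P := by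
    intro u c h
    have hne : (A.filter (fun v => u + t * (v - u) ∈ A ∧ c + t * (v - c) ∈ A)).Nonempty := by
      rw [← Finset.card_pos]
      have : (0:ℝ) < ((A.filter (fun v => u + t * (v - u) ∈ A ∧
        c + t * (v - c) ∈ A)).card : ℝ) := lt_of_lt_of_le hθ0 h
      exact_mod_cast this
    rw [hP, Finset.mem_filter]
    constructor
    · obtain ⟨v, hv⟩ := hne
      have hv := (Finset.mem_filter.1 hv).2
      have : (1 - t) * (u - c) = (u + t * (v - u)) - (c + t * (v - c)) := by ring
      rw [this]
      exact Finset.sub_mem_sub hv.1 hv.2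
    · refine h.trans ?_
      norm_cast
      refine Finset.card_le_card_of_injOn (fun v => (u + t * (v - u), c + t * (v - c))) ?_ ?_
      · intro v hv
        simp only [Finset.coe_filter, Set.mem_ofPred_eq, Finset.mem_product] at hv ⊢
        exact ⟨hv.2, by ring⟩
      · intro v _ v' _ h
        have h := (Prod.ext_iff.1 h).1
        simp only [add_right_inj] at h
        exact sub_left_injective (mul_left_cancel₀ ht0 h)
  have hz : ∀ z ∈ A'' - A'', ∃ u ∈ A'', ∃ u' ∈ A'', u - u' = z := fun z hz =>
    Finset.mem_sub.1 hz
  choose! f hf g hg hfg using hz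
  have hcs : ∀ z ∈ A'' - A'', k / 2 ≤ ((A'.filter (fun c => (1 - t) * (f z - c) ∈ P ∧
      (1 - t) * (g z - c) ∈ P)).card : ℝ) := by
    intro z hz
    set S1 := A'.filter (fun c => ((A.filter (fun v => f z + t * (v - f z) ∈ A ∧
      c + t * (v - c) ∈ A)).card : ℝ) < θ) with hS1
    set S2 := A'.filter (fun c => ((A.filter (fun v => g z + t * (v - g z) ∈ A ∧
      c + t * (v - c) ∈ A)).card : ℝ) < θ) with hS2
    have b1 : 4 * (S1.card : ℝ) ≤ k := by convert hgood _ (hf z hz)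
    have b2 : 4 * (S2.card : ℝ) ≤ k := by convert hgood _ (hg z hz)
    have hsub : A' ⊆ (A'.filter (fun c => (1 - t) * (f z - c) ∈ P ∧
      (1 - t) * (g z - c) ∈ P)) ∪ (S1 ∪ S2) := by
      intro c hc
      by_cases c1 : c ∈ S1
      · simp [c1]
      by_cases c2 : c ∈ S2
      · simp [c2]
      have c1' := fun h => c1 (Finset.mem_filter.2 ⟨hc, h⟩)
      have c2' := fun h => c2 (Finset.mem_filter.2 ⟨hc, h⟩)
      exact Finset.mem_union_left _ (Finset.mem_filter.2
        ⟨hc, hPmem _ _ (not_lt.1 c1'), hPmem _ _ (not_lt.1 c2')⟩)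
    have hcard := (Finset.card_le_card hsub).trans ((Finset.card_union_le _ _).trans
      (Nat.add_le_add_left (Finset.card_union_le _ _) _))
    have hcard' : k ≤ ((A'.filter (fun c => (1 - t) * (f z - c) ∈ P ∧
      (1 - t) * (g z - c) ∈ P)).card : ℝ) + ((S1.card : ℝ) + S2.card) := by
      rw [hk]; exact_mod_cast hcard
    linarith
  have hinj : (((A'' - A'').sigma (fun z => A'.filter (fun c => (1 - t) * (f z - c) ∈ P ∧
      (1 - t) * (g z - c) ∈ P))).card) ≤ (P ×ˢ P).card := by
    refine Finset.card_le_card_of_injOn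
      (fun p => ((1 - t) * (f p.1 - p.2), (1 - t) * (g p.1 - p.2))) ?_ ?_
    · rintro ⟨z, c⟩ hp
      simp only [Finset.coe_sigma, Set.mem_sigma_iff, Finset.mem_coe, Finset.mem_filter] at hp
      simp only [Finset.coe_product, Set.mem_prod, Finset.mem_coe]
      exact hp.2.2
    · rintro ⟨z, c⟩ hp ⟨z', c'⟩ hp' h
      simp only [Finset.coe_sigma, Set.mem_sigma_iff, Finset.mem_coe, Finset.mem_filter] at hp hp'
      have ht : 1 - t ≠ 0 := sub_ne_zero.2 ht1.symm
      have h1 := mul_left_cancel₀ ht (Prod.ext_iff.1 h).1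
      have h2 := mul_left_cancel₀ ht (Prod.ext_iff.1 h).2
      simp only [] at h1 h2
      have e1 := hfg z hp.1
      have e2 := hfg z' hp'.1
      have hzz : z = z' := by rw [← e1, ← e2]; linear_combination h1 - h2
      subst hzz
      have hcc : c = c' := by linear_combination -h1
      rw [hcc]
  rw [Finset.card_sigma, Finset.card_product] at hinj
  have hfin : ((A'' - A'').card : ℝ) * (k / 2) ≤ (P.card : ℝ) ^ 2 := by
    calc ((A'' - A'').card : ℝ) * (k / 2) = ∑ z ∈ A'' - A'', k / 2 := by
          rw [Finset.sum_const, nsmul_eq_mul]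
      _ ≤ ∑ z ∈ A'' - A'', ((A'.filter (fun c => (1 - t) * (f z - c) ∈ P ∧
            (1 - t) * (g z - c) ∈ P)).card : ℝ) := Finset.sum_le_sum hcs
      _ ≤ (P.card : ℝ) ^ 2 := by rw [sq]; exact_mod_cast hinj
  have hPsq : ((P.card : ℝ) * θ) ^ 2 ≤ (n ^ 2) ^ 2 := by gcongr
  set X : ℝ := ((A'' - A'').card : ℝ) with hX
  have hX0 : 0 ≤ X := Nat.cast_nonneg _
  have s1 : X * (k / 2) * θ ^ 2 ≤ n ^ 4 := by
    calc X * (k / 2) * θ ^ 2 ≤ (P.card : ℝ) ^ 2 * θ ^ 2 := by gcongr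
      _ = ((P.card : ℝ) * θ) ^ 2 := by ring
      _ ≤ _ := hPsq.trans (by ring_nf; rfl)
  have s2 : X * (a * n / 2 / 2) * θ ^ 2 ≤ n ^ 4 := by
    refine le_trans ?_ s1
    gcongr
  rw [hθ] at s2
  have s3 : n ^ 3 * (X * a ^ 5) ≤ n ^ 3 * (4096 * n) := by
    calc n ^ 3 * (X * a ^ 5) = 4096 * (X * (a * n / 2 / 2) * (a ^ 2 * n / 32) ^ 2) := by ring
      _ ≤ 4096 * n ^ 4 := by gcongr
      _ = _ := by ring
  exact le_of_mul_le_mul_left s3 (by positivity)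

theorem step1 [Fintype F] (A B : Finset F) (hB : 2 ≤ B.card) (hA : A.Nonempty) (L α : ℝ)
    (hα : 0 < α)
    (hL : ((Finset.univ.filter (fun l : F × F => 2 ≤ rr A B l)).card : ℝ) ≤ L)
    (hαL : α ^ 2 * L ≤ (A.card : ℝ) ^ 2) (hm8 : 8 ≤ (B.card : ℝ) * α) :
    ∃ A₁ ⊆ A, α / 16 * A.card ≤ (A₁.card : ℝ) ∧
      ((A₁ - A₁).card : ℝ) * (α / 8) ^ 5 ≤ 4096 * A.card := by
  obtain ⟨T0, hT0c, hT0, -, hsum⟩ := exists_T0 A B hB hA L α hα hL hαL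
  set m : ℝ := (B.card : ℝ) with hm
  set n : ℝ := (A.card : ℝ) with hn
  have hnpos : 0 < n := by rw [hn]; exact_mod_cast hA.card_pos
  have hNt1 : ∀ t, (Nt A t : ℝ) ≤ n ^ 2 := by
    intro t
    have h : Nt A t ≤ A.card * A.card := by
      unfold Nt
      rw [← Finset.card_product]; exact Finset.card_filter_le _ _
    have := (Nat.cast_le (α := ℝ)).2 h
    rw [Nat.cast_mul] at this
    exact this.trans (sq n).ge
  have hs2 : m * α / 8 * n ^ 2 ≤ ∑ t ∈ T0.erase 1, (Nt A t : ℝ) := by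
    have : ∑ t ∈ T0, (Nt A t : ℝ) ≤ n ^ 2 + ∑ t ∈ T0.erase 1, (Nt A t : ℝ) := by
      by_cases h1 : (1 : F) ∈ T0
      · rw [← Finset.add_sum_erase _ _ h1]
        have := hNt1 1
        linarith
      · rw [Finset.erase_eq_of_notMem h1]
        have := sq_nonneg n
        linarith
    have h8 : 8 * n ^ 2 ≤ m * α * n ^ 2 := by gcongr
    linarith
  have hpos : 0 < m * α / 8 * n ^ 2 := by
    have : 0 < m * α := by linarith
    positivity
  have hne : (T0.erase 1).Nonempty := by
    by_contra h
    rw [Finset.not_nonempty_iff_eq_empty] at h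
    rw [h, Finset.sum_empty] at hs2
    linarith
  obtain ⟨t, ht, htN⟩ : ∃ t ∈ T0.erase 1, α / 8 * n ^ 2 ≤ (Nt A t : ℝ) := by
    refine Finset.exists_le_of_sum_le hne ?_
    refine le_trans ?_ hs2
    rw [Finset.sum_const, nsmul_eq_mul]
    have hc : ((T0.erase 1).card : ℝ) ≤ m := by
      rw [hm]; exact_mod_cast (Finset.card_le_card (Finset.erase_subset _ _)).trans hT0c
    calc ((T0.erase 1).card : ℝ) * (α / 8 * n ^ 2) ≤ m * (α / 8 * n ^ 2) := by gcongr
      _ = _ := by ring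
  obtain ⟨A₁, h1, h2, h3⟩ := bsg A t (hT0 t (Finset.mem_of_mem_erase ht))
    (Finset.ne_of_mem_erase ht) (α / 8) (by positivity) hA htN
  refine ⟨A₁, h1, ?_, h3⟩
  calc α / 16 * n = α / 8 / 2 * n := by ring
    _ ≤ _ := h2

theorem step2 [Fintype F] (A B : Finset F) (hB : 2 ≤ B.card) (hA : A.Nonempty) (L δ : ℝ)
    (hδ : 0 < δ)
    (hL : ((Finset.univ.filter (fun l : F × F => 2 ≤ rr A B l)).card : ℝ) ≤ L)
    (hδL : δ ^ 2 * L ≤ (A.card : ℝ) ^ 2) (hn8 : 8 ≤ (A.card : ℝ) * δ) :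
    ∃ T : Finset F, (∀ t ∈ T, t ≠ 0) ∧ δ / 16 * B.card ≤ (T.card : ℝ) ∧ Str A T (δ / 16) ∧
      ∃ a0 a1 : F, a1 ≠ a0 ∧
        δ / 16 * T.card ≤ ((T.filter (fun t => a0 + t * (a1 - a0) ∈ A)).card : ℝ) := by
  obtain ⟨T0, hT0c, hT0, -, hsum⟩ := exists_T0 A B hB hA L δ hδ hL hδL
  set m : ℝ := (B.card : ℝ) with hm
  set n : ℝ := (A.card : ℝ) with hn
  have hnpos : 0 < n := by rw [hn]; exact_mod_cast hA.card_pos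
  have hm2 : 2 ≤ m := by rw [hm]; exact_mod_cast hB
  have hT0m : (T0.card : ℝ) ≤ m := by rw [hm]; exact_mod_cast hT0c
  have hsw : ∑ t ∈ T0, (Nt A t : ℝ) =
      ∑ a0 ∈ A, ∑ t ∈ T0, ((A.filter (fun a1 => a0 + t * (a1 - a0) ∈ A)).card : ℝ) := by
    rw [Finset.sum_comm]
    refine Finset.sum_congr rfl fun t _ => ?_
    unfold Nt
    rw [← Nat.cast_sum, Finset.card_filter, Finset.sum_product]
    simp only [Finset.card_filter]
  obtain ⟨a0, ha0, h0⟩ : ∃ a0 ∈ A, m * δ / 4 * n ≤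
      ∑ t ∈ T0, ((A.filter (fun a1 => a0 + t * (a1 - a0) ∈ A)).card : ℝ) := by
    refine Finset.exists_le_of_sum_le hA ?_
    rw [← hsw]
    refine le_trans ?_ hsum
    rw [Finset.sum_const, nsmul_eq_mul]
    apply le_of_eq; ring
  set N : F → ℝ := fun t => (((A.erase a0).filter (fun a1 => a0 + t * (a1 - a0) ∈ A)).card : ℝ)
    with hN
  have hNle : ∀ t, N t ≤ n := by
    intro t
    simp only [hN, hn]
    exact_mod_cast (Finset.card_filter_le _ _).trans (Finset.card_le_card (Finset.erase_subset _ _))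
  have hN1 : ∀ t, ((A.filter (fun a1 => a0 + t * (a1 - a0) ∈ A)).card : ℝ) ≤ N t + 1 := by
    intro t
    have hsub : A.filter (fun a1 => a0 + t * (a1 - a0) ∈ A) ⊆
      insert a0 ((A.erase a0).filter (fun a1 => a0 + t * (a1 - a0) ∈ A)) := by
      intro x hx
      rw [Finset.mem_filter] at hx
      by_cases h : x = a0
      · simp [h]
      · exact Finset.mem_insert_of_mem (Finset.mem_filter.2
          ⟨Finset.mem_erase.2 ⟨h, hx.1⟩, hx.2⟩)
    have := (Finset.card_le_card hsub).trans (Finset.card_insert_le _ _)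
    simp only [hN]
    exact_mod_cast this
  have h1 : m * δ / 8 * n ≤ ∑ t ∈ T0, N t := by
    have h2 : ∑ t ∈ T0, ((A.filter (fun a1 => a0 + t * (a1 - a0) ∈ A)).card : ℝ) ≤
        ∑ t ∈ T0, (N t + 1) := Finset.sum_le_sum fun t _ => hN1 t
    rw [Finset.sum_add_distrib, Finset.sum_const, nsmul_eq_mul] at h2
    have : m * 8 ≤ m * (n * δ) := by gcongr
    linarith
  set T := T0.filter (fun t => δ / 16 * n ≤ N t) with hT
  have hTc : δ / 16 * m ≤ (T.card : ℝ) := by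
    have hb : ∑ t ∈ T0, N t ≤ ∑ t ∈ T0, (δ / 16 * n + if δ / 16 * n ≤ N t then n else 0) := by
      refine Finset.sum_le_sum fun t _ => ?_
      split_ifs with h
      · have := hNle t
        have : 0 < δ / 16 * n := by positivity
        linarith
      · push Not at h
        linarith
    rw [Finset.sum_add_distrib, Finset.sum_const, nsmul_eq_mul, ← Finset.sum_filter,
      Finset.sum_const, nsmul_eq_mul, ← hT] at hb
    have hc : (T0.card : ℝ) * (δ / 16 * n) ≤ m * (δ / 16 * n) := by gcongr
    have : δ / 16 * m * n ≤ (T.card : ℝ) * n := by linarith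
    exact le_of_mul_le_mul_right this hnpos
  have hTpos : 0 < (T.card : ℝ) := lt_of_lt_of_le (by positivity) hTc
  refine ⟨T, fun t ht => hT0 t (Finset.mem_filter.1 ht).1, hTc, ?_, a0, ?_⟩
  · intro t ht
    have ht' := Finset.mem_filter.1 ht
    have htne := hT0 t ht'.1
    refine ⟨((A.erase a0).filter (fun a1 => a0 + t * (a1 - a0) ∈ A)).image
      (fun a1 => a0 + t * (a1 - a0)), ?_, ?_, a0 - t * a0, ?_⟩
    · intro w hw
      obtain ⟨a, ha, rfl⟩ := Finset.mem_image.1 hw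
      exact (Finset.mem_filter.1 ha).2
    · rw [Finset.card_image_of_injOn]
      · exact ht'.2
      · intro x _ y _ h
        simp only [add_right_inj] at h
        exact sub_left_injective (mul_left_cancel₀ htne h)
    · intro w hw
      obtain ⟨a, ha, rfl⟩ := Finset.mem_image.1 hw
      exact ⟨a, Finset.mem_of_mem_erase (Finset.mem_filter.1 ha).1, by ring⟩
  · have hdc : ∑ a1 ∈ A.erase a0, ((T.filter (fun t => a0 + t * (a1 - a0) ∈ A)).card : ℝ) =
        ∑ t ∈ T, N t := by
      rw [hN, ← Nat.cast_sum, ← Nat.cast_sum]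
      congr 1
      exact Finset.sum_card_bipartiteAbove_eq_sum_card_bipartiteBelow
        (fun a1 t => a0 + t * (a1 - a0) ∈ A)
    have hlow : (T.card : ℝ) * (δ / 16 * n) ≤ ∑ t ∈ T, N t := by
      rw [← nsmul_eq_mul, ← Finset.sum_const]
      exact Finset.sum_le_sum fun t ht => (Finset.mem_filter.1 ht).2
    have hne : (A.erase a0).Nonempty := by
      by_contra h
      rw [Finset.not_nonempty_iff_eq_empty] at h
      rw [← hdc, h, Finset.sum_empty] at hlow
      have : 0 < (T.card : ℝ) * (δ / 16 * n) := by positivity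
      linarith
    obtain ⟨a1, ha1, h⟩ : ∃ a1 ∈ A.erase a0, δ / 16 * T.card ≤
        ((T.filter (fun t => a0 + t * (a1 - a0) ∈ A)).card : ℝ) := by
      refine Finset.exists_le_of_sum_le hne ?_
      rw [hdc]
      refine le_trans ?_ hlow
      rw [Finset.sum_const, nsmul_eq_mul]
      have hc : ((A.erase a0).card : ℝ) ≤ n := by
        rw [hn]; exact_mod_cast (Finset.card_le_card (Finset.erase_subset _ _))
      calc ((A.erase a0).card : ℝ) * (δ / 16 * T.card) ≤ n * (δ / 16 * T.card) := by gcongr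
        _ = _ := by ring
    exact ⟨a1, Finset.ne_of_mem_erase ha1, h⟩

set_option exponentiation.threshold 1000 in
set_option maxHeartbeats 1600000 in
theorem core [Fintype F] (A B : Finset F) (C L V α : ℝ) (hB : 2 ≤ B.card)
    (hBA : B.card ≤ A.card) (hC : 0 < C) (hα : 0 < α) (hα1 : α ≤ 1)
    (hL : ((Finset.univ.filter (fun l : F × F => 2 ≤ rr A B l)).card : ℝ) ≤ L)
    (hαL : α ^ 2 * L = (A.card : ℝ) ^ 2)
    (hS : subfieldCond A C V)
    (H0 : (2:ℝ) ^ 800 ≤ α ^ 191 * B.card)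
    (H1 : (2:ℝ) ^ 800 * A.card ≤ α ^ 191 * (B.card : ℝ) ^ 2)
    (H1' : (2:ℝ) ^ 800 * (C ^ 2 * A.card) ≤ α ^ 191 * (B.card : ℝ) ^ 2)
    (H2 : (2:ℝ) ^ 800 * A.card ≤ α ^ 103 * Fintype.card F)
    (H3 : (2:ℝ) ^ 800 * (C * V) ≤ α ^ 31 * B.card) : False := by
  have hAne : A.Nonempty := Finset.card_pos.1 (by omega)
  set m : ℝ := (B.card : ℝ) with hm
  set n : ℝ := (A.card : ℝ) with hn
  have hnpos : 0 < n := by rw [hn]; exact_mod_cast hAne.card_pos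
  have hm2 : 2 ≤ m := by rw [hm]; exact_mod_cast hB
  have hmn : m ≤ n := by rw [hm, hn]; exact_mod_cast hBA
  have hpw : ∀ {i j : ℕ}, i ≤ j → α ^ j ≤ α ^ i := fun h =>
    pow_le_pow_of_le_one hα.le hα1 h
  have hpm : ∀ i : ℕ, i ≤ 191 → (2:ℝ) ^ 800 ≤ α ^ i * m := by
    intro i hi
    refine H0.trans ?_
    have := hpw hi
    gcongr
  have hpn : ∀ i : ℕ, i ≤ 191 → (2:ℝ) ^ 800 ≤ α ^ i * n := by
    intro i hi
    refine (hpm i hi).trans ?_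
    gcongr
  obtain ⟨A₁, hA₁, hn1, hD⟩ := step1 A B hB hAne L α hα hL hαL.le (by
    have := hpm 1 (by norm_num)
    rw [pow_one] at this
    rw [mul_comm]
    refine le_trans ?_ this
    norm_num)
  rw [← hn] at hn1 hD
  set n₁ : ℝ := (A₁.card : ℝ) with hn₁
  have hn1pos : 0 < n₁ := lt_of_lt_of_le (by positivity) hn1
  have hn1n : n₁ ≤ n := by rw [hn₁, hn]; exact_mod_cast Finset.card_le_card hA₁
  have hA1ne : A₁.Nonempty := by
    rw [← Finset.card_pos]; rw [hn₁] at hn1pos; exact_mod_cast hn1pos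
  have hL1 : ((Finset.univ.filter (fun l : F × F => 2 ≤ rr A₁ B l)).card : ℝ) ≤ L := by
    refine le_trans ?_ hL
    norm_cast
    refine Finset.card_le_card fun l hl => ?_
    rw [Finset.mem_filter] at hl ⊢
    refine ⟨hl.1, hl.2.trans ?_⟩
    unfold rr
    refine Finset.card_le_card fun b hb => ?_
    rw [Finset.mem_filter] at hb ⊢
    exact ⟨hb.1, hA₁ hb.2⟩
  obtain ⟨T, hT0, hTc, hStr, a0, a1, ha, hline⟩ := step2 A₁ B hB hA1ne L (α ^ 2 / 16)
    (by positivity) hL1 (by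
      rw [← hn₁]
      calc (α ^ 2 / 16) ^ 2 * L = (α / 16) ^ 2 * (α ^ 2 * L) := by ring
        _ = (α / 16 * n) ^ 2 := by rw [hαL]; ring
        _ ≤ n₁ ^ 2 := by gcongr) (by
      rw [← hn₁]
      have := hpn 3 (by norm_num)
      calc (8:ℝ) ≤ 2 ^ 800 / 256 := by norm_num
        _ ≤ α ^ 3 * n / 256 := by gcongr
        _ = (α / 16 * n) * (α ^ 2 / 16) := by ring
        _ ≤ _ := by gcongr)
  have hβe : α ^ 2 / 16 / 16 = α ^ 2 / 256 := by ring
  rw [hβe] at hTc hStr hline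
  rw [← hm] at hTc
  set τ : ℝ := (T.card : ℝ) with hτ
  have hτpos : 0 < τ := lt_of_lt_of_le (by positivity) hTc
  have hτsq : α ^ 4 * m ^ 2 / 2 ^ 16 ≤ τ ^ 2 := by
    calc α ^ 4 * m ^ 2 / 2 ^ 16 = (α ^ 2 / 256 * m) ^ 2 := by ring
      _ ≤ _ := by gcongr
  have hκ01 : α ^ 138 / 2 ^ 700 ≤ α ^ 94 / 2 ^ 468 := by
    have := hpw (show 94 ≤ 138 by norm_num)
    gcongr
    · norm_num
    · norm_num
  have hn8 : 8 ≤ α ^ 138 / 2 ^ 700 * n₁ := by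
    have := hpn 139 (by norm_num)
    calc (8:ℝ) ≤ 2 ^ 800 / 2 ^ 704 := by norm_num
      _ ≤ α ^ 139 * n / 2 ^ 704 := by gcongr
      _ = α ^ 138 / 2 ^ 700 * (α / 16 * n) := by ring
      _ ≤ _ := by gcongr
  have key1 : ¬ (α ^ 138 / 2 ^ 700 * τ ^ 2 ≤ 16 * n₁) := by
    intro h
    have h1 : α ^ 142 * m ^ 2 ≤ 2 ^ 720 * n := by
      calc α ^ 142 * m ^ 2 = 2 ^ 716 * (α ^ 138 / 2 ^ 700 * (α ^ 4 * m ^ 2 / 2 ^ 16)) := by ring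
        _ ≤ 2 ^ 716 * (α ^ 138 / 2 ^ 700 * τ ^ 2) := by gcongr
        _ ≤ 2 ^ 716 * (16 * n) := by
          refine mul_le_mul_of_nonneg_left ?_ (by positivity)
          linarith
        _ = _ := by ring
    have h2 : α ^ 191 * m ^ 2 ≤ α ^ 142 * m ^ 2 := by
      have := hpw (show 142 ≤ 191 by norm_num)
      gcongr
    have h3 : (2:ℝ) ^ 800 * n ≤ 2 ^ 720 * n := by linarith
    have h4 := le_of_mul_le_mul_right h3 hnpos
    norm_num at h4
  have key0 : ¬ (α ^ 94 / 2 ^ 468 * τ ^ 2 ≤ 16 * n₁) := by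
    intro h
    refine key1 (le_trans ?_ h)
    gcongr
  have hDD : ((A₁ - A₁).card : ℝ) ≤ 2 ^ 31 / α ^ 6 * n₁ := by
    have h1 : ((A₁ - A₁).card : ℝ) * α ^ 6 ≤ 2 ^ 31 * n₁ := by
      calc ((A₁ - A₁).card : ℝ) * α ^ 6 = 2 ^ 15 * α * (((A₁ - A₁).card : ℝ) * (α / 8) ^ 5) := by
            ring
        _ ≤ 2 ^ 15 * α * (4096 * n) := by gcongr
        _ = 2 ^ 31 * (α / 16 * n) := by ring
        _ ≤ _ := by gcongr
    rw [div_mul_eq_mul_div, le_div_iff₀ (by positivity)]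
    exact h1
  have hdiv : α ^ 2 / 256 / (2 ^ 31 / α ^ 6) = α ^ 8 / 2 ^ 39 := by
    field_simp; norm_num
  have hT2 : 2 ≤ T.card := by
    have : (2:ℝ) ≤ τ := by
      refine le_trans ?_ hTc
      have := hpm 2 (by norm_num)
      calc (2:ℝ) ≤ 2 ^ 800 / 256 := by norm_num
        _ ≤ α ^ 2 * m / 256 := by gcongr
        _ = _ := by ring
    rw [hτ] at this
    exact_mod_cast this
  have E0 : α ^ 94 / 2 ^ 468 = (α ^ 8 / 2 ^ 39) ^ 8 / (2 * (2 ^ 31 / α ^ 6) ^ 5) := by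
    field_simp
  have E1 : α ^ 138 / 2 ^ 686 = (α ^ 8 / 2 ^ 39) ^ 12 / (2 * (2 ^ 31 / α ^ 6) ^ 7) := by
    field_simp
  have E2 : α ^ 110 / 2 ^ 546 = (α ^ 8 / 2 ^ 39) ^ 10 / (2 * (2 ^ 31 / α ^ 6) ^ 5) := by
    field_simp
  rcases dichotomy A₁ T (α ^ 2 / 256) (2 ^ 31 / α ^ 6) (α ^ 94 / 2 ^ 468) (α ^ 138 / 2 ^ 700)
    hA1ne hT0 hT2 (by positivity) (by positivity) hDD hStr
    (by rw [hdiv, E0])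
    (by
      rw [hdiv, ← E1]
      gcongr
      · norm_num
      · norm_num)
    (by
      rw [hdiv, ← E2]
      have := hpw (show 110 ≤ 138 by norm_num)
      gcongr
      · norm_num
      · norm_num)
    (by positivity) (by positivity)
    (hn8.trans (by gcongr)) hn8 with h | ⟨G, hTG, hG⟩
  · exact key1 (by linarith)
  · by_cases hGt : G = ⊤
    · rcases min_choice (τ ^ 2) (Nat.card G : ℝ) with h | h
      · rw [h] at hG; exact key0 hG
      · rw [h] at hG
        have hq : (Nat.card G : ℝ) = Fintype.card F := by
          subst hGt
          rw [Nat.card_congr (Subfield.topEquiv (K := F)).toEquiv, Nat.card_eq_fintype_card]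
        rw [hq] at hG
        set q : ℝ := (Fintype.card F : ℝ) with hqd
        have hq0 : 0 ≤ q := Nat.cast_nonneg _
        have h1 : α ^ 94 * q ≤ 2 ^ 472 * n := by
          calc α ^ 94 * q = 2 ^ 468 * (α ^ 94 / 2 ^ 468 * q) := by ring
            _ ≤ 2 ^ 468 * (16 * n) := by
              refine mul_le_mul_of_nonneg_left ?_ (by positivity)
              linarith
            _ = _ := by ring
        have h2 : α ^ 103 * q ≤ α ^ 94 * q := by
          have := hpw (show 94 ≤ 103 by norm_num)
          gcongr
        have h3 : (2:ℝ) ^ 800 * n ≤ 2 ^ 472 * n := by linarith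
        have h4 := le_of_mul_le_mul_right h3 hnpos
        norm_num at h4
    · have hsub := hS G hGt (a1 - a0) a0
      have hcnt : α ^ 2 / 256 * τ ≤ ((A.filter fun x => ∃ g ∈ G, x = (a1 - a0) * g + a0).card : ℝ) := by
        refine hline.trans (Nat.cast_le.2 ?_)
        refine Finset.card_le_card_of_injOn (fun t => a0 + t * (a1 - a0)) ?_ ?_
        · intro t ht
          simp only [Finset.coe_filter, Set.mem_ofPred_eq] at ht ⊢
          exact ⟨hA₁ ht.2, t, hTG t ht.1, by ring⟩
        · intro t _ t' _ h
          simp only [add_right_inj] at h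
          exact mul_right_cancel₀ (sub_ne_zero.2 ha) h
      have hmain : α ^ 2 / 256 * τ ≤ C * max ((Nat.card G : ℝ) ^ ((1:ℝ)/2)) V := by
        refine hcnt.trans (le_trans (le_of_eq ?_) hsub)
        congr!
      rcases max_choice ((Nat.card G : ℝ) ^ ((1:ℝ)/2)) V with h | h
      · rw [h] at hmain
        rw [← Real.sqrt_eq_rpow] at hmain
        set g : ℝ := (Nat.card G : ℝ) with hg
        have hg0 : 0 ≤ g := Nat.cast_nonneg _
        have hsq : (α ^ 2 / 256 * τ) ^ 2 ≤ C ^ 2 * g := by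
          calc (α ^ 2 / 256 * τ) ^ 2 ≤ (C * √g) ^ 2 := by gcongr
            _ = C ^ 2 * g := by rw [mul_pow, Real.sq_sqrt hg0]
        rcases min_choice (τ ^ 2) g with h' | h'
        · rw [h'] at hG; exact key0 hG
        · rw [h'] at hG
          have h1 : α ^ 102 * m ^ 2 ≤ 2 ^ 504 * (C ^ 2 * n) := by
            calc α ^ 102 * m ^ 2 = 2 ^ 500 * (α ^ 94 / 2 ^ 468 *
                  ((α ^ 2 / 256) ^ 2 * (α ^ 4 * m ^ 2 / 2 ^ 16))) := by ring
              _ ≤ 2 ^ 500 * (α ^ 94 / 2 ^ 468 * ((α ^ 2 / 256) ^ 2 * τ ^ 2)) := by gcongr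
              _ = 2 ^ 500 * (α ^ 94 / 2 ^ 468 * (α ^ 2 / 256 * τ) ^ 2) := by ring
              _ ≤ 2 ^ 500 * (α ^ 94 / 2 ^ 468 * (C ^ 2 * g)) := by gcongr
              _ = 2 ^ 500 * (C ^ 2 * (α ^ 94 / 2 ^ 468 * g)) := by ring
              _ ≤ 2 ^ 500 * (C ^ 2 * (16 * n)) := by
                refine mul_le_mul_of_nonneg_left (mul_le_mul_of_nonneg_left ?_ (by positivity))
                  (by positivity)
                linarith
              _ = _ := by ring
          have h2 : α ^ 191 * m ^ 2 ≤ α ^ 102 * m ^ 2 := by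
            have := hpw (show 102 ≤ 191 by norm_num)
            gcongr
          have h3 : (2:ℝ) ^ 800 * (C ^ 2 * n) ≤ 2 ^ 504 * (C ^ 2 * n) := by linarith
          have h4 := le_of_mul_le_mul_right h3 (by positivity)
          norm_num at h4
      · rw [h] at hmain
        have h1 : α ^ 4 * m ≤ 2 ^ 16 * (C * V) := by
          calc α ^ 4 * m = 2 ^ 16 * (α ^ 2 / 256 * (α ^ 2 / 256 * m)) := by ring
            _ ≤ 2 ^ 16 * (α ^ 2 / 256 * τ) := by gcongr
            _ ≤ _ := by
              refine mul_le_mul_of_nonneg_left hmain (by positivity)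
        have h0 : 0 < α ^ 4 * m := by positivity
        have h2 : α ^ 31 * m ≤ α ^ 4 * m := by
          have := hpw (show 4 ≤ 31 by norm_num)
          gcongr
        have hCV : 0 < C * V := by
          by_contra hcon
          push Not at hcon
          linarith
        have h3 : (2:ℝ) ^ 800 * (C * V) ≤ 2 ^ 16 * (C * V) := by linarith
        have h4 := le_of_mul_le_mul_right h3 hCV
        norm_num at h4

theorem rpow_aux (x : ℝ) (hx : 0 ≤ x) (a b : ℕ) (hb : b ≠ 0) :
    (x ^ ((a : ℝ) / b)) ^ b = x ^ a := by
  rw [← Real.rpow_natCast (x ^ ((a : ℝ) / b)) b, ← Real.rpow_mul hx,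
    div_mul_cancel₀ _ (by exact_mod_cast hb), Real.rpow_natCast]

theorem lines_lower [Fintype F] (A B : Finset F) (hB : 2 ≤ B.card) :
    A.card ^ 2 ≤ (Finset.univ.filter (fun l : F × F => 2 ≤ rr A B l)).card := by
  obtain ⟨b, hb, b', hb', hne⟩ := Finset.one_lt_card.1 (show 1 < B.card by omega)
  refine (pair_count A hne).trans (Finset.card_le_card fun l hl => ?_)
  rw [Finset.mem_filter] at hl ⊢
  refine ⟨Finset.mem_univ _, ?_⟩
  unfold rr
  refine Finset.one_lt_card.2 ⟨b, ?_, b', ?_, hne⟩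
  · exact Finset.mem_filter.2 ⟨hb, hl.2.1⟩
  · exact Finset.mem_filter.2 ⟨hb', hl.2.2⟩

/-- the numerical deductions from a hypothetical small number of lines -/
theorem numerics (C n m q L ε K : ℝ) (hC : 0 < C) (hm : 2 ≤ m) (hmn : m ≤ n) (hq : 0 ≤ q)
    (hLn : n ^ 2 ≤ L) (hK : 1 ≤ K) (hε : ε = 1 / (K * (1 + C) ^ 2))
    (h1 : L < ε ^ 2 * (n ^ ((380:ℝ)/191) * m ^ ((4:ℝ)/191)))
    (h2 : L < ε ^ 2 * (q ^ ((2:ℝ)/103) * n ^ ((204:ℝ)/103))) :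
    ∃ α : ℝ, 0 < α ∧ α ≤ 1 ∧ α ^ 2 * L = n ^ 2 ∧ K ≤ α ^ 191 * m ∧
      K * n ≤ α ^ 191 * m ^ 2 ∧ K * (C ^ 2 * n) ≤ α ^ 191 * m ^ 2 ∧ K * n ≤ α ^ 103 * q ∧
      K * (C * (n ^ ((31:ℝ)/191) * m ^ ((129:ℝ)/191))) ≤ α ^ 31 * m := by
  have hm0 : 0 < m := by linarith
  have hn0 : 0 < n := by linarith
  have hL0 : 0 < L := lt_of_lt_of_le (by positivity) hLn
  have hK0 : 0 < K := by linarith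
  have hM : 1 ≤ K * (1 + C) ^ 2 := by nlinarith
  have hε0 : 0 < ε := by rw [hε]; positivity
  have hε1 : ε ≤ 1 := by rw [hε, div_le_one (by linarith)]; exact hM
  have hεM : K * (1 + C) ^ 2 * ε = 1 := by rw [hε]; field_simp
  set α : ℝ := n / √L with hα
  have hs : 0 < √L := Real.sqrt_pos.2 hL0
  have hα0 : 0 < α := by positivity
  have hαL : α ^ 2 * L = n ^ 2 := by
    rw [hα, div_pow, Real.sq_sqrt hL0.le]; field_simp
  have hα1 : α ≤ 1 := by
    rw [hα, div_le_one hs]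
    exact Real.le_sqrt_of_sq_le hLn
  have hω : ∀ k : ℕ, k ≠ 0 → (ε * α) ^ k ≤ ε * α ^ k := by
    intro k hk
    rw [mul_pow]
    have : ε ^ k ≤ ε := pow_le_of_le_one hε0.le hε1 hk
    gcongr
  have e1 : n < (ε * α) ^ 191 * m ^ 2 := by
    have ha := rpow_aux n hn0.le 380 191 (by norm_num)
    have hb := rpow_aux m hm0.le 4 191 (by norm_num)
    push_cast at ha hb
    have h : L ^ 191 < (ε ^ 2 * (n ^ ((380:ℝ)/191) * m ^ ((4:ℝ)/191))) ^ 191 := by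
      gcongr
    rw [mul_pow, mul_pow, ha, hb] at h
    have h' : (n ^ 2) ^ 191 < (α ^ 2) ^ 191 * ((ε ^ 2) ^ 191 * (n ^ 380 * m ^ 4)) := by
      rw [← hαL, mul_pow]
      gcongr
    have h'' : n ^ 380 * n ^ 2 < n ^ 380 * ((ε * α) ^ 191 * m ^ 2) ^ 2 := by
      calc n ^ 380 * n ^ 2 = (n ^ 2) ^ 191 := by ring
        _ < _ := h'
        _ = _ := by ring
    have := lt_of_mul_lt_mul_left h'' (pow_nonneg hn0.le _)
    have hpos : 0 ≤ (ε * α) ^ 191 * m ^ 2 := mul_nonneg (pow_nonneg (by positivity) _) (sq_nonneg m)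
    exact lt_of_pow_lt_pow_left₀ 2 hpos this
  have e2 : n < (ε * α) ^ 103 * q := by
    have ha := rpow_aux q hq 2 103 (by norm_num)
    have hb := rpow_aux n hn0.le 204 103 (by norm_num)
    push_cast at ha hb
    have h : L ^ 103 < (ε ^ 2 * (q ^ ((2:ℝ)/103) * n ^ ((204:ℝ)/103))) ^ 103 := by
      gcongr
    rw [mul_pow, mul_pow, ha, hb] at h
    have h' : (n ^ 2) ^ 103 < (α ^ 2) ^ 103 * ((ε ^ 2) ^ 103 * (q ^ 2 * n ^ 204)) := by
      rw [← hαL, mul_pow]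
      gcongr
    have h'' : n ^ 204 * n ^ 2 < n ^ 204 * ((ε * α) ^ 103 * q) ^ 2 := by
      calc n ^ 204 * n ^ 2 = (n ^ 2) ^ 103 := by ring
        _ < _ := h'
        _ = _ := by ring
    have := lt_of_mul_lt_mul_left h'' (pow_nonneg hn0.le _)
    have hpos : 0 ≤ (ε * α) ^ 103 * q :=
      mul_nonneg (pow_nonneg (mul_nonneg hε0.le hα0.le) _) hq
    exact lt_of_pow_lt_pow_left₀ 2 hpos this
  set V : ℝ := n ^ ((31:ℝ)/191) * m ^ ((129:ℝ)/191) with hV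
  have hV0 : 0 ≤ V := by positivity
  have e3 : V ≤ (ε * α) ^ 31 * m := by
    have ha := rpow_aux n hn0.le 31 191 (by norm_num)
    have hb := rpow_aux m hm0.le 129 191 (by norm_num)
    push_cast at ha hb
    refine le_of_pow_le_pow_left₀ (n := 191) (by norm_num) (by positivity) ?_
    rw [hV, mul_pow, ha, hb]
    calc n ^ 31 * m ^ 129 ≤ ((ε * α) ^ 191 * m ^ 2) ^ 31 * m ^ 129 := by gcongr
      _ = _ := by ring
  have f1 : n ≤ ε * α ^ 191 * m ^ 2 := by
    refine e1.le.trans ?_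
    have := hω 191 (by norm_num)
    gcongr
  have f2 : n ≤ ε * α ^ 103 * q := by
    refine e2.le.trans ?_
    have := hω 103 (by norm_num)
    gcongr
  have f3 : V ≤ ε * α ^ 31 * m := by
    refine e3.trans ?_
    have := hω 31 (by norm_num)
    gcongr
  have f0 : 1 ≤ ε * α ^ 191 * m := by
    have : m * 1 ≤ m * (ε * α ^ 191 * m) := by
      calc m * 1 ≤ n := by linarith
        _ ≤ _ := f1
        _ = _ := by ring
    exact le_of_mul_le_mul_left this hm0
  have c1 : (1:ℝ) ≤ (1 + C) ^ 2 := by nlinarith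
  have c2 : C ^ 2 ≤ (1 + C) ^ 2 := by nlinarith
  have c3 : C ≤ (1 + C) ^ 2 := by nlinarith
  have gen : ∀ x c y : ℝ, 0 ≤ x → c ≤ (1 + C) ^ 2 → x ≤ ε * y → K * (c * x) ≤ y := by
    intro x c y hx hc hxy
    calc K * (c * x) ≤ K * ((1 + C) ^ 2 * x) := by gcongr
      _ = K * (1 + C) ^ 2 * x := by ring
      _ ≤ K * (1 + C) ^ 2 * (ε * y) := by gcongr
      _ = (K * (1 + C) ^ 2 * ε) * y := by ring
      _ = y := by rw [hεM, one_mul]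
  refine ⟨α, hα0, hα1, hαL, ?_, ?_, ?_, ?_, ?_⟩
  · have := gen 1 1 (α ^ 191 * m) (by norm_num) c1 (by linarith)
    linarith
  · have := gen n 1 (α ^ 191 * m ^ 2) hn0.le c1 (by linarith)
    linarith
  · exact gen n (C ^ 2) (α ^ 191 * m ^ 2) hn0.le c2 (by linarith)
  · have := gen n 1 (α ^ 103 * q) hn0.le c1 (by linarith)
    linarith
  · exact gen V C (α ^ 31 * m) hV0 c3 (by linarith)

theorem stmt2 : ∀ C : ℝ, 0 < C → ∃ c' : ℝ, 0 < c' ∧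
    ∀ (F : Type) [Field F] [Fintype F] (q : ℕ), IsPrimePow q → Fintype.card F = q →
    ∀ A B : Finset F, 2 ≤ B.card → B.card ≤ A.card →
    subfieldCond A C ((A.card : ℝ) ^ ((31:ℝ)/191) * (B.card : ℝ) ^ ((129:ℝ)/191)) →
    c' * min (min ((A.card : ℝ) ^ ((380:ℝ)/191) * (B.card : ℝ) ^ ((4:ℝ)/191))
        ((q : ℝ) ^ ((2:ℝ)/103) * (A.card : ℝ) ^ ((204:ℝ)/103)))
        ((B.card : ℝ) ^ (4:ℕ)) ≤ (numLines (A ×ˢ B) : ℝ) := by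
  intro C hC
  obtain ⟨K, hK⟩ : ∃ K : ℝ, K = 2 ^ 800 := ⟨_, rfl⟩
  have hK1 : 1 ≤ K := hK ▸ one_le_pow₀ (by norm_num)
  obtain ⟨ε, hε⟩ : ∃ ε : ℝ, ε = 1 / (K * (1 + C) ^ 2) := ⟨_, rfl⟩
  have hε0 : 0 < ε := by
    have : 0 < K := lt_of_lt_of_le one_pos hK1
    rw [hε]; positivity
  refine ⟨ε ^ 2, by positivity, ?_⟩
  intro F _ _ q hq hqF A B hB hBA hS
  by_contra hcon
  push Not at hcon
  have hlow : (A.card : ℝ) ^ 2 ≤ (numLines (A ×ˢ B) : ℝ) := by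
    exact_mod_cast (lines_lower A B hB).trans (lines_le A B)
  have hL : ((Finset.univ.filter (fun l : F × F => 2 ≤ rr A B l)).card : ℝ) ≤
      (numLines (A ×ˢ B) : ℝ) := by
    exact_mod_cast lines_le A B
  obtain ⟨α, hα0, hα1, hαL, g0, g1, g2, g3, g4⟩ := numerics C A.card B.card q
    (numLines (A ×ˢ B)) ε K hC (by exact_mod_cast hB) (by exact_mod_cast hBA)
    (Nat.cast_nonneg _) hlow hK1 hε
    (lt_of_lt_of_le hcon (mul_le_mul_of_nonneg_left
      ((min_le_left _ _).trans (min_le_left _ _)) (by positivity)))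
    (lt_of_lt_of_le hcon (mul_le_mul_of_nonneg_left
      ((min_le_left _ _).trans (min_le_right _ _)) (by positivity)))
  rw [hK] at g0 g1 g2 g3 g4
  rw [← hqF] at g3
  exact core A B C _ _ α hB hBA hC hα0 hα1 hL hαL hS g0 g1 g2 g3 g4

end STP
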